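/- arXiv:2306.04113 — 4 statements merged into one kernel-verified Lean document; each statement's English description precedes it below -/
import Mathlib

section
/- Let F be an FN lattice (a simple, infinite, semidistributive lattice), let n ≥ 1, and let U ⊆ F be an antichain with n elements. Let F[U] be the lattice obtained by doubling every element of U, and for each u ∈ U let θ_u be the congruence of F[U] generated by (u₀, u₁). Then for each subset V ⊆ U the join θ[V] of { θ_u : u ∈ V } is a congruence of F[U], the map V ↦ θ[V] is a lattice embedding of the Boolean lattice of subsets of U into Con F[U], and the congruence lattice of F[U] consists exactly of the all relation together with the congruences θ[V] for V ⊆ U; hence Con F[U] is isomorphic to Bₙ⁺, the Boolean lattice with n atoms with a new greatest element adjoined. -/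
/-! ### Basic definitions: semidistributivity, lattice congruences -/

/-- Join-semidistributivity: `u = x ⊔ y = x ⊔ z` implies `u = x ⊔ (y ⊓ z)`. -/
def JoinSD (L : Type*) [Lattice L] : Prop :=
  ∀ u x y z : L, u = x ⊔ y → u = x ⊔ z → u = x ⊔ (y ⊓ z)

/-- Meet-semidistributivity: `w = x ⊓ y = x ⊓ z` implies `w = x ⊓ (y ⊔ z)`. -/
def MeetSD (L : Type*) [Lattice L] : Prop :=
  ∀ w x y z : L, w = x ⊓ y → w = x ⊓ z → w = x ⊓ (y ⊔ z)

/-- Semidistributivity. -/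
def SD (L : Type*) [Lattice L] : Prop := JoinSD L ∧ MeetSD L

/-- A congruence of a lattice: an equivalence relation compatible with `⊔` and `⊓`. -/
@[ext]
structure LatCon (L : Type*) [Lattice L] where
  r : L → L → Prop
  refl' : ∀ x, r x x
  symm' : ∀ {x y}, r x y → r y x
  trans' : ∀ {x y z}, r x y → r y z → r x z
  sup' : ∀ {x y x' y'}, r x y → r x' y' → r (x ⊔ x') (y ⊔ y')
  inf' : ∀ {x y x' y'}, r x y → r x' y' → r (x ⊓ x') (y ⊓ y')

namespace LatCon

variable {L : Type*} [Lattice L]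

/-- Congruences are ordered by inclusion; this is the order of the congruence
lattice `Con L`. -/
instance instPO : PartialOrder (LatCon L) where
  le c d := ∀ x y, c.r x y → d.r x y
  le_refl _ _ _ h := h
  le_trans _ _ _ h1 h2 x y h := h2 x y (h1 x y h)
  le_antisymm c d h1 h2 := by
    ext x y
    exact ⟨h1 x y, h2 x y⟩

/-- The congruence lattice `Con L`. -/
instance instLattice : Lattice (LatCon L) where
  sup c d :=
    { r := fun x y => ∀ e : LatCon L, c ≤ e → d ≤ e → e.r x y
      refl' := fun x e _ _ => e.refl' x
      symm' := fun h e hc hd => e.symm' (h e hc hd)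
      trans' := fun h1 h2 e hc hd => e.trans' (h1 e hc hd) (h2 e hc hd)
      sup' := fun h1 h2 e hc hd => e.sup' (h1 e hc hd) (h2 e hc hd)
      inf' := fun h1 h2 e hc hd => e.inf' (h1 e hc hd) (h2 e hc hd) }
  le_sup_left c d := fun x y h e hc _ => hc x y h
  le_sup_right c d := fun x y h e _ hd => hd x y h
  sup_le c d e hc hd := fun x y h => h e hc hd
  inf c d :=
    { r := fun x y => c.r x y ∧ d.r x y
      refl' := fun x => ⟨c.refl' x, d.refl' x⟩
      symm' := fun h => ⟨c.symm' h.1, d.symm' h.2⟩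
      trans' := fun h1 h2 => ⟨c.trans' h1.1 h2.1, d.trans' h1.2 h2.2⟩
      sup' := fun h1 h2 => ⟨c.sup' h1.1 h2.1, d.sup' h1.2 h2.2⟩
      inf' := fun h1 h2 => ⟨c.inf' h1.1 h2.1, d.inf' h1.2 h2.2⟩ }
  inf_le_left c d := fun x y h => h.1
  inf_le_right c d := fun x y h => h.2
  le_inf c d e hc hd := fun x y h => ⟨hc x y h, hd x y h⟩

/-- The equality congruence is the least congruence. -/
instance instOrderBot : OrderBot (LatCon L) where
  bot :=
    { r := Eq
      refl' := fun _ => rfl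
      symm' := Eq.symm
      trans' := Eq.trans
      sup' := by rintro x y x' y' rfl rfl; rfl
      inf' := by rintro x y x' y' rfl rfl; rfl }
  bot_le c := by rintro x y rfl; exact c.refl' x

/-- The all congruence is the greatest congruence. -/
instance instOrderTop : OrderTop (LatCon L) where
  top :=
    { r := fun _ _ => True
      refl' := fun _ => trivial
      symm' := fun _ => trivial
      trans' := fun _ _ => trivial
      sup' := fun _ _ => trivial
      inf' := fun _ _ => trivial }
  le_top _ _ _ _ := trivial

/-- The congruence generated by a pair `(a, b)`. -/
def gen (a b : L) : LatCon L where
  r x y := ∀ c : LatCon L, c.r a b → c.r x y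
  refl' x := fun c _ => c.refl' x
  symm' h := fun c hc => c.symm' (h c hc)
  trans' h1 h2 := fun c hc => c.trans' (h1 c hc) (h2 c hc)
  sup' h1 h2 := fun c hc => c.sup' (h1 c hc) (h2 c hc)
  inf' h1 h2 := fun c hc => c.inf' (h1 c hc) (h2 c hc)

/-- The congruence generated by a set of pairs. -/
def genSet (P : Set (L × L)) : LatCon L where
  r x y := ∀ c : LatCon L, (∀ p ∈ P, c.r p.1 p.2) → c.r x y
  refl' x := fun c _ => c.refl' x
  symm' h := fun c hc => c.symm' (h c hc)
  trans' h1 h2 := fun c hc => c.trans' (h1 c hc) (h2 c hc)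
  sup' h1 h2 := fun c hc => c.sup' (h1 c hc) (h2 c hc)
  inf' h1 h2 := fun c hc => c.inf' (h1 c hc) (h2 c hc)

end LatCon

/-- A lattice is simple if its congruence lattice has exactly two elements, namely
the equality relation (`⊥`) and the all relation (`⊤`). -/
def IsSimpleLat (L : Type*) [Lattice L] : Prop :=
  (∃ x y : L, x ≠ y) ∧ ∀ c : LatCon L, c = (⊥ : LatCon L) ∨ c = (⊤ : LatCon L)

/-- An FN lattice: a simple, infinite, semidistributive lattice. -/
def IsFN (F : Type*) [Lattice F] : Prop := Infinite F ∧ IsSimpleLat F ∧ SD F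

/-! ### Helpers for quantifying over lattice structures -/

/-- `SD` for an explicitly given lattice structure. -/
def SDP (K : Type*) (instK : Lattice K) : Prop := by
  letI := instK; exact SD K

/-- `IsFN` for an explicitly given lattice structure. -/
def IsFNP (F : Type*) (instF : Lattice F) : Prop := by
  letI := instF; exact IsFN F

/-- The congruence lattice of `K` (with explicitly given lattice structure) is
order-isomorphic to `D`. -/
def ConIso (K : Type*) (instK : Lattice K) (D : Type*) [LE D] : Prop := by
  letI := instK; exact Nonempty (LatCon K ≃o D)

/-- `K` (with explicitly given lattice structure) has no greatest and no least element. -/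
def UnboundedP (K : Type*) (instK : Lattice K) : Prop := by
  letI := instK; exact (∀ x : K, ¬ IsTop x) ∧ (∀ x : K, ¬ IsBot x)

/-- The order `≤` of an explicitly given lattice structure. -/
def lleOf {α : Type*} (inst : Lattice α) (x y : α) : Prop := by
  letI := inst; exact x ≤ y

/-- The join of an explicitly given lattice structure. -/
def lsupOf {α : Type*} (inst : Lattice α) (x y : α) : α := by
  letI := inst; exact x ⊔ y

/-- The meet of an explicitly given lattice structure. -/
def linfOf {α : Type*} (inst : Lattice α) (x y : α) : α := by
  letI := inst; exact x ⊓ y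

/-! ### The doubling construction -/

/-- The underlying set of the doubling `L[u]`: `(L ∖ {u}) ∪ {u₀, u₁}`, where
`u₀ = Sum.inr false` and `u₁ = Sum.inr true`. -/
def Doubled (L : Type*) (u : L) : Type _ := {x : L // x ≠ u} ⊕ Bool

/-- The element `u₀` of `L[u]`. -/
def dbl0 {L : Type*} (u : L) : Doubled L u := Sum.inr false

/-- The element `u₁` of `L[u]`. -/
def dbl1 {L : Type*} (u : L) : Doubled L u := Sum.inr true

/-- The order `≤ᵤ` of the doubling `L[u]`. -/
def dle {L : Type*} [Lattice L] (u : L) : Doubled L u → Doubled L u → Prop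
  | Sum.inl x, Sum.inl y => (x : L) ≤ y
  | Sum.inl x, Sum.inr _ => (x : L) ≤ u
  | Sum.inr _, Sum.inl y => u ≤ (y : L)
  | Sum.inr i, Sum.inr j => i ≤ j

section
open Classical

/-- The map `L → L[u]` sending `u` to `u₀` and fixing everything else. -/
noncomputable def iota0 {L : Type*} (u : L) : L → Doubled L u := fun x =>
  if h : x = u then Sum.inr false else Sum.inl ⟨x, h⟩

/-- The map `L → L[u]` sending `u` to `u₁` and fixing everything else. -/
noncomputable def iota1 {L : Type*} (u : L) : L → Doubled L u := fun x =>
  if h : x = u then Sum.inr true else Sum.inl ⟨x, h⟩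

end

/-- The projection `L[u] → L` collapsing `u₀` and `u₁` to `u`. -/
def dproj {L : Type*} (u : L) : Doubled L u → L
  | Sum.inl x => (x : L)
  | Sum.inr _ => u

/-! ### Doubling a finite antichain -/

/-- The underlying set of `L[U]`: `(L ∖ U) ∪ ⋃_{u ∈ U} {u₀, u₁}`, where
`u₀ = Sum.inr (u, false)` and `u₁ = Sum.inr (u, true)`. -/
def DoubledS (L : Type*) (U : Set L) : Type _ := {x : L // x ∉ U} ⊕ (U × Bool)

section
open Classical

/-- The order of `L[U]`. -/
noncomputable def dleS {L : Type*} [Lattice L] (U : Set L) : DoubledS L U → DoubledS L U → Prop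
  | Sum.inl x, Sum.inl y => (x : L) ≤ y
  | Sum.inl x, Sum.inr ui => (x : L) ≤ (ui.1 : L)
  | Sum.inr ui, Sum.inl y => (ui.1 : L) ≤ (y : L)
  | Sum.inr ui, Sum.inr vj =>
      if (ui.1 : L) = (vj.1 : L) then ui.2 ≤ vj.2 else (ui.1 : L) ≤ (vj.1 : L)

end

/-! ### Isolated intervals and the gluing construction -/

/-- An interval `[a, b]` is isolated if `b` covers `a` and both `a` and `b` are
doubly irreducible. -/
def Isolated {L : Type*} [Lattice L] (a b : L) : Prop :=
  a ⋖ b ∧ SupIrred a ∧ InfIrred a ∧ SupIrred b ∧ InfIrred b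

/-- The underlying set of `K = L^{a,b} ⊔ F`. -/
def Glued (L F : Type*) (a b : L) : Type _ := {x : L // x ≠ a ∧ x ≠ b} ⊕ F

/-- The order on `K = L^{a,b} ⊔ F`: on each summand the original order; and
`x < f` for `x ∈ L^{a,b}`, `f ∈ F` iff `x ≤ a`, `f < x` iff `b ≤ x`. -/
def gle {L F : Type*} [Lattice L] [Lattice F] (a b : L) :
    Glued L F a b → Glued L F a b → Prop
  | Sum.inl x, Sum.inl y => (x : L) ≤ y
  | Sum.inl x, Sum.inr _ => (x : L) ≤ a
  | Sum.inr _, Sum.inl y => b ≤ (y : L)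
  | Sum.inr f, Sum.inr g => f ≤ g


/-! ### Simple semidistributive lattices have no bounds -/

/-- In a nontrivial join-semidistributive lattice with greatest element, some proper ideal is
prime. -/
theorem JoinSD.exists_prime {L : Type*} [Lattice L] (h : JoinSD L) {t : L} (ht : IsTop t)
    (hne : ∃ x, x ≠ t) :
    ∃ p : L → Prop, (∀ x y, p (x ⊔ y) ↔ p x ∧ p y) ∧ (∀ x y, p (x ⊓ y) ↔ p x ∨ p y) ∧
      ¬ p t ∧ ∃ x, p x := by
  obtain ⟨x₀, hx₀⟩ := hne
  obtain ⟨I, hxI, ⟨hlow, hsup, htI⟩, hmax⟩ := zorn_subset_nonempty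
    {I : Set L | IsLowerSet I ∧ SupClosed I ∧ t ∉ I}
    (by
      intro C hC hchain _
      refine ⟨⋃₀ C, ⟨?_, ?_, ?_⟩, fun s hs => Set.subset_sUnion_of_mem hs⟩
      · exact isLowerSet_sUnion fun s hs => (hC hs).1
      · rintro a ⟨s, hs, has⟩ b ⟨s', hs', hbs⟩
        rcases hchain.total hs hs' with hle | hle
        · exact ⟨s', hs', (hC hs').2.1 (hle has) hbs⟩
        · exact ⟨s, hs, (hC hs).2.1 has (hle hbs)⟩
      · rintro ⟨s, hs, hts⟩
        exact (hC hs).2.2 hts)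
    (Set.Iic x₀)
    ⟨isLowerSet_Iic x₀, fun a ha b hb => sup_le ha hb, fun h => hx₀ (le_antisymm (ht _) h)⟩
  have compl (y : L) (hy : y ∉ I) : ∃ i ∈ I, t = i ⊔ y := by
    by_contra! hcon
    refine hy (hmax (y := {z | ∃ i ∈ I, z ≤ i ⊔ y}) ⟨?_, ?_, ?_⟩ ?_
      ⟨x₀, hxI le_rfl, le_sup_right⟩)
    · rintro a b hba ⟨i, hi, hai⟩
      exact ⟨i, hi, hba.trans hai⟩
    · rintro a ⟨i, hi, hai⟩ b ⟨j, hj, hbj⟩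
      refine ⟨i ⊔ j, hsup hi hj, sup_le (hai.trans ?_) (hbj.trans ?_)⟩
      · exact sup_le_sup_right le_sup_left y
      · exact sup_le_sup_right le_sup_right y
    · rintro ⟨i, hi, hti⟩
      exact hcon i hi (le_antisymm hti (ht _))
    · exact fun i hi => ⟨i, hi, le_sup_left⟩
  refine ⟨(· ∈ I), fun x y => ⟨fun hxy => ⟨hlow le_sup_left hxy, hlow le_sup_right hxy⟩,
    fun hxy => hsup hxy.1 hxy.2⟩, fun x y => ⟨fun hxy => ?_, ?_⟩, htI, x₀, hxI le_rfl⟩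
  · by_contra! hcon
    obtain ⟨i, hi, hix⟩ := compl x hcon.1
    obtain ⟨j, hj, hjy⟩ := compl y hcon.2
    have hx : t = (i ⊔ j) ⊔ x := le_antisymm (hix.le.trans (sup_le_sup_right le_sup_left x)) (ht _)
    have hy : t = (i ⊔ j) ⊔ y := le_antisymm (hjy.le.trans (sup_le_sup_right le_sup_right y)) (ht _)
    exact htI (h t _ _ _ hx hy ▸ hsup (hsup hi hj) hxy)
  · rintro (hx | hy)
    · exact hlow inf_le_left hx
    · exact hlow inf_le_right hy

/-- The two-class congruence whose classes are a prime ideal and its complement. -/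
def LatCon.ofPrime {L : Type*} [Lattice L] (p : L → Prop) (hsup : ∀ x y, p (x ⊔ y) ↔ p x ∧ p y)
    (hinf : ∀ x y, p (x ⊓ y) ↔ p x ∨ p y) : LatCon L where
  r x y := p x ↔ p y
  refl' _ := Iff.rfl
  symm' := Iff.symm
  trans' := Iff.trans
  sup' h h' := by rw [hsup, hsup, h, h']
  inf' h h' := by rw [hinf, hinf, h, h']

theorem IsSimpleLat.not_exists_prime {L : Type*} [Lattice L] [Infinite L] (h : IsSimpleLat L)
    (p : L → Prop) (hsup : ∀ x y, p (x ⊔ y) ↔ p x ∧ p y) (hinf : ∀ x y, p (x ⊓ y) ↔ p x ∨ p y)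
    {s t : L} (hs : p s) (ht : ¬ p t) : False := by
  rcases h.2 (LatCon.ofPrime p hsup hinf) with hc | hc
  · refine not_injective_infinite_finite p fun x y hxy => ?_
    have : (LatCon.ofPrime p hsup hinf).r x y := iff_of_eq hxy
    rwa [hc] at this
  · have : (LatCon.ofPrime p hsup hinf).r s t := by rw [hc]; trivial
    exact ht (this.1 hs)

theorem IsFN.not_isTop {F : Type*} [Lattice F] (hF : IsFN F) (t : F) : ¬ IsTop t := by
  intro ht
  obtain ⟨hinf, hsimple, hsd⟩ := hF
  obtain ⟨p, h1, h2, h3, x, hx⟩ := hsd.1.exists_prime ht (exists_ne t)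
  exact hsimple.not_exists_prime p h1 h2 hx h3

theorem MeetSD.joinSD_dual {L : Type*} [Lattice L] (h : MeetSD L) : JoinSD Lᵒᵈ := h

theorem IsFN.not_isBot {F : Type*} [Lattice F] (hF : IsFN F) (t : F) : ¬ IsBot t := by
  intro ht
  obtain ⟨hinf, hsimple, hsd⟩ := hF
  obtain ⟨p, h1, h2, h3, x, hx⟩ :=
    hsd.2.joinSD_dual.exists_prime (t := OrderDual.toDual t) ht (exists_ne _)
  refine hsimple.not_exists_prime (fun a => ¬ p (OrderDual.toDual a)) (fun a b => ?_)
    (fun a b => ?_) h3 (not_not.2 hx : ¬ ¬ p (OrderDual.toDual (OrderDual.ofDual x)))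
  · rw [toDual_sup, h2, not_or]
  · rw [toDual_inf, h1, not_and_or]

/-- Collapsing a principal ideal `Iic u` in a lattice in which everything is comparable to `u`. -/
def LatCon.collapseIic {L : Type*} [Lattice L] (u : L) (hu : ∀ x, x ≤ u ∨ u ≤ x) : LatCon L where
  r x y := x = y ∨ x ≤ u ∧ y ≤ u
  refl' _ := .inl rfl
  symm' := by
    rintro x y (rfl | ⟨hx, hy⟩)
    exacts [.inl rfl, .inr ⟨hy, hx⟩]
  trans' := by
    rintro x y z (rfl | ⟨hx, hy⟩) (rfl | ⟨hy', hz⟩)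
    exacts [.inl rfl, .inr ⟨hy', hz⟩, .inr ⟨hx, hy⟩, .inr ⟨hx, hz⟩]
  sup' := by
    rintro x y x' y' (rfl | ⟨hx, hy⟩) (rfl | ⟨hx', hy'⟩)
    · exact .inl rfl
    · rcases hu x with h | h
      · exact .inr ⟨sup_le h hx', sup_le h hy'⟩
      · rw [sup_eq_left.2 (hx'.trans h), sup_eq_left.2 (hy'.trans h)]
        exact .inl rfl
    · rcases hu x' with h | h
      · exact .inr ⟨sup_le hx h, sup_le hy h⟩
      · rw [sup_eq_right.2 (hx.trans h), sup_eq_right.2 (hy.trans h)]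
        exact .inl rfl
    · exact .inr ⟨sup_le hx hx', sup_le hy hy'⟩
  inf' := by
    rintro x y x' y' (rfl | ⟨hx, hy⟩) (rfl | ⟨hx', hy'⟩)
    · exact .inl rfl
    · exact .inr ⟨inf_le_of_right_le hx', inf_le_of_right_le hy'⟩
    · exact .inr ⟨inf_le_of_left_le hx, inf_le_of_left_le hy⟩
    · exact .inr ⟨inf_le_of_left_le hx, inf_le_of_left_le hy⟩

theorem IsFN.exists_incomparable {F : Type*} [Lattice F] (hF : IsFN F) (u : F) :
    ∃ x, ¬ x ≤ u ∧ ¬ u ≤ x := by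
  by_contra! h
  have hu (x : F) : x ≤ u ∨ u ≤ x := or_iff_not_imp_left.2 (h x)
  rcases hF.2.1.2 (LatCon.collapseIic u hu) with hc | hc
  · refine hF.not_isBot u fun x => (hu x).elim (fun hx => ?_) id
    have : (LatCon.collapseIic u hu).r x u := .inr ⟨hx, le_rfl⟩
    rw [hc] at this
    exact this.ge
  · refine hF.not_isTop u fun x => ?_
    have : (LatCon.collapseIic u hu).r x u := by rw [hc]; trivial
    exact this.elim (·.le) (·.1)

/-! ### Collapsing a covering pair of a meet- and a join-irreducible element -/

/-- A pair `a < b` such that every element below `b` is `b` or lies below `a`, and every element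
above `a` is `a` or lies above `b`. -/
structure IsDoublingPair {L : Type*} [Lattice L] (a b : L) : Prop where
  lt : a < b
  le_left_of_le : ∀ {x}, x ≤ b → x = b ∨ x ≤ a
  right_le_of_le : ∀ {x}, a ≤ x → x = a ∨ b ≤ x

namespace IsDoublingPair

variable {L : Type*} [Lattice L] {a b : L}

theorem sup_cases (h : IsDoublingPair a b) (z : L) :
    (a ⊔ z = a ∧ b ⊔ z = b) ∨ a ⊔ z = b ⊔ z := by
  rcases h.right_le_of_le (le_sup_left : a ≤ a ⊔ z) with hz | hz
  · exact .inl ⟨hz, sup_eq_left.2 ((sup_eq_left.1 hz).trans h.lt.le)⟩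
  · exact .inr (le_antisymm (sup_le_sup_right h.lt.le z) (sup_le hz le_sup_right))

theorem inf_cases (h : IsDoublingPair a b) (z : L) :
    (a ⊓ z = a ∧ b ⊓ z = b) ∨ a ⊓ z = b ⊓ z := by
  rcases h.le_left_of_le (inf_le_left : b ⊓ z ≤ b) with hz | hz
  · exact .inl ⟨inf_eq_left.2 (h.lt.le.trans (inf_eq_left.1 hz)), hz⟩
  · exact .inr (le_antisymm (inf_le_inf_right z h.lt.le) (le_inf hz inf_le_right))

end IsDoublingPair

namespace LatCon

variable {L : Type*} [Lattice L]

/-- A congruence from an equivalence relation compatible with the operations in one argument. -/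
def ofOneSided (r : L → L → Prop) (hr : Equivalence r)
    (hsup : ∀ x y z, r x y → r (x ⊔ z) (y ⊔ z)) (hinf : ∀ x y z, r x y → r (x ⊓ z) (y ⊓ z)) :
    LatCon L where
  r := r
  refl' := hr.refl
  symm' := hr.symm
  trans' := hr.trans
  sup' {x y x' y'} h h' := by
    refine hr.trans (hsup _ _ x' h) ?_
    rw [sup_comm y, sup_comm y]
    exact hsup _ _ _ h'
  inf' {x y x' y'} h h' := by
    refine hr.trans (hinf _ _ x' h) ?_
    rw [inf_comm y, inf_comm y]
    exact hinf _ _ _ h'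

/-- The congruence obtained from `d` by merging the classes of a doubling pair. -/
def merge (d : LatCon L) {a b : L} (h : IsDoublingPair a b) : LatCon L :=
  ofOneSided (fun x y => d.r x y ∨ (d.r x a ∨ d.r x b) ∧ (d.r y a ∨ d.r y b))
    { refl := fun x => .inl (d.refl' x)
      symm := fun h => h.imp d.symm' And.symm
      trans := by
        rintro x y z (hxy | ⟨hx, hy⟩) (hyz | ⟨hy', hz⟩)
        · exact .inl (d.trans' hxy hyz)
        · exact .inr ⟨hy'.imp (d.trans' hxy) (d.trans' hxy), hz⟩
        · exact .inr ⟨hx, hy.imp (d.trans' (d.symm' hyz)) (d.trans' (d.symm' hyz))⟩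
        · exact .inr ⟨hx, hz⟩ }
    (by
      rintro x y z (hxy | ⟨hx, hy⟩)
      · exact .inl (d.sup' hxy (d.refl' z))
      have key {w : L} (hw : d.r w a ∨ d.r w b) : d.r (w ⊔ z) (a ⊔ z) ∨ d.r (w ⊔ z) (b ⊔ z) :=
        hw.imp (d.sup' · (d.refl' z)) (d.sup' · (d.refl' z))
      have kx := key hx
      have ky := key hy
      rcases h.sup_cases z with ⟨ha, hb⟩ | hab
      · rw [ha, hb] at kx ky
        exact .inr ⟨kx, ky⟩
      · rw [hab, or_self] at kx ky
        exact .inl (d.trans' kx (d.symm' ky)))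
    (by
      rintro x y z (hxy | ⟨hx, hy⟩)
      · exact .inl (d.inf' hxy (d.refl' z))
      have key {w : L} (hw : d.r w a ∨ d.r w b) : d.r (w ⊓ z) (a ⊓ z) ∨ d.r (w ⊓ z) (b ⊓ z) :=
        hw.imp (d.inf' · (d.refl' z)) (d.inf' · (d.refl' z))
      have kx := key hx
      have ky := key hy
      rcases h.inf_cases z with ⟨ha, hb⟩ | hab
      · rw [ha, hb] at kx ky
        exact .inr ⟨kx, ky⟩
      · rw [hab, or_self] at kx ky
        exact .inl (d.trans' kx (d.symm' ky)))

/-- If collapsing a doubling pair on top of a proper congruence collapses everything, then every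
element is below the lower or above the upper element of the pair. -/
theorem le_or_le_of_sup_gen_eq_top {d : LatCon L} {a b : L} (h : IsDoublingPair a b)
    (htop : d ⊔ gen a b = ⊤) (hd : d ≠ ⊤) (x : L) : x ≤ a ∨ b ≤ x := by
  have hab : ¬ d.r a b := fun hab => hd <| by
    rw [← htop, eq_comm, sup_eq_left]
    exact fun x y hxy => hxy d hab
  have hle : d ⊔ gen a b ≤ d.merge h :=
    sup_le (fun x y hxy => .inl hxy)
      fun x y hxy => hxy _ (.inr ⟨.inl (d.refl' a), .inr (d.refl' b)⟩)
  have hx : d.r x a ∨ d.r x b := by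
    have : (d.merge h).r x a := hle x a (by rw [htop]; trivial)
    exact this.elim .inl (·.1)
  rcases hx with hx | hx
  · left
    rcases h.right_le_of_le (le_sup_left : a ≤ a ⊔ x) with hax | hax
    · exact sup_eq_left.1 hax
    · refine absurd ?_ hab
      have h1 := d.inf' (d.sup' (d.refl' a) hx) (d.refl' b)
      rw [sup_idem, inf_eq_right.2 hax, inf_eq_left.2 h.lt.le] at h1
      exact d.symm' h1
  · right
    rcases h.le_left_of_le (inf_le_left : b ⊓ x ≤ b) with hbx | hbx
    · exact inf_eq_left.1 hbx
    · refine absurd ?_ hab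
      have h1 := d.sup' (d.inf' (d.refl' b) hx) (d.refl' a)
      rw [inf_idem, sup_eq_right.2 hbx, sup_eq_left.2 h.lt.le] at h1
      exact h1

theorem gen_le_iff {a b : L} {c : LatCon L} : gen a b ≤ c ↔ c.r a b :=
  ⟨fun h => h a b fun _ h => h, fun h _ _ hxy => hxy c h⟩

theorem genSet_le_iff {P : Set (L × L)} {c : LatCon L} :
    genSet P ≤ c ↔ ∀ p ∈ P, c.r p.1 p.2 :=
  ⟨fun h p hp => h p.1 p.2 fun _ h => h p hp, fun h _ _ hxy => hxy c h⟩

end LatCon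

/-! ### The doubling `L[U]` -/

namespace DoubledS

variable {F : Type*} {U : Set F}

/-- The projection `L[U] → L`. -/
def proj : DoubledS F U → F
  | Sum.inl x => x
  | Sum.inr ui => ui.1

open Classical in
/-- The section of `proj` sending `u ∈ U` to `(u, i)`. -/
noncomputable def lift (i : Bool) (x : F) : DoubledS F U :=
  if h : x ∈ U then Sum.inr (⟨x, h⟩, i) else Sum.inl ⟨x, h⟩

/-- The copy `(u, i)` of `u ∈ U` in `L[U]`. -/
def copy (u : U) (i : Bool) : DoubledS F U := Sum.inr (u, i)

theorem lift_of_mem {x : F} (h : x ∈ U) (i : Bool) : lift i x = copy (⟨x, h⟩ : U) i :=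
  dif_pos h

theorem lift_of_notMem {x : F} (h : x ∉ U) (i : Bool) :
    lift i x = (Sum.inl ⟨x, h⟩ : DoubledS F U) :=
  dif_neg h

theorem proj_lift (i : Bool) (x : F) : proj (lift (U := U) i x) = x := by
  by_cases h : x ∈ U
  · rw [lift_of_mem h]
    rfl
  · rw [lift_of_notMem h]
    rfl

theorem eq_or_of_proj_eq {x y : DoubledS F U} (h : proj x = proj y) :
    x = y ∨ ∃ u : U, proj x = u ∧
      (x = copy u false ∧ y = copy u true ∨ x = copy u true ∧ y = copy u false) := by
  rcases x with ⟨x, hx⟩ | ⟨⟨u, hu⟩, i⟩ <;> rcases y with ⟨y, hy⟩ | ⟨⟨v, hv⟩, j⟩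
  · obtain rfl : x = y := h
    exact .inl rfl
  · obtain rfl : x = v := h
    exact absurd hv hx
  · obtain rfl : u = y := h
    exact absurd hu hy
  · obtain rfl : u = v := h
    cases i <;> cases j
    · exact .inl rfl
    · exact .inr ⟨⟨u, hu⟩, rfl, .inl ⟨rfl, rfl⟩⟩
    · exact .inr ⟨⟨u, hu⟩, rfl, .inr ⟨rfl, rfl⟩⟩
    · exact .inl rfl

variable [Lattice F]

theorem dleS_lift_true (x : DoubledS F U) (a : F) : dleS U x (lift true a) ↔ proj x ≤ a := by
  by_cases h : a ∈ U
  · rw [lift_of_mem h]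
    rcases x with x | ⟨u, i⟩
    · rfl
    · by_cases hu : (u : F) = a <;> simp [dleS, proj, copy, hu]
  · rw [lift_of_notMem h]
    rcases x with x | ⟨u, i⟩ <;> rfl

theorem lift_false_dleS (x : DoubledS F U) (a : F) : dleS U (lift false a) x ↔ a ≤ proj x := by
  by_cases h : a ∈ U
  · rw [lift_of_mem h]
    rcases x with x | ⟨u, i⟩
    · rfl
    · by_cases hu : a = u <;> simp [dleS, proj, copy, hu]
  · rw [lift_of_notMem h]
    rcases x with x | ⟨u, i⟩ <;> rfl

variable [Lattice (DoubledS F U)] (hord : ∀ x y : DoubledS F U, x ≤ y ↔ dleS U x y)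

include hord

theorem proj_sup (x y : DoubledS F U) : proj (x ⊔ y) = proj x ⊔ proj y :=
  GaloisConnection.l_sup (l := proj) (u := lift true) fun x a =>
    ((hord _ _).trans (dleS_lift_true x a)).symm

theorem proj_inf (x y : DoubledS F U) : proj (x ⊓ y) = proj x ⊓ proj y :=
  GaloisConnection.u_inf (l := lift false) (u := proj) fun a x =>
    (hord _ _).trans (lift_false_dleS x a)

theorem isDoublingPair_copy (u : U) : IsDoublingPair (copy u false) (copy u true) where
  lt := by
    rw [lt_iff_le_not_ge, hord, hord]
    simp [dleS, copy]
  le_left_of_le {x} hx := by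
    rw [hord] at hx ⊢
    rcases x with x | ⟨v, i⟩
    · exact .inr hx
    · by_cases hv : v = u
      · subst hv
        cases i
        · simp [dleS, copy]
        · exact .inl rfl
      · have hv' : (v : F) ≠ u := fun h => hv (Subtype.ext h)
        simp only [dleS, copy, hv', if_false] at hx ⊢
        exact .inr hx
  right_le_of_le {x} hx := by
    rw [hord] at hx ⊢
    rcases x with x | ⟨v, i⟩
    · exact .inr hx
    · by_cases hv : u = v
      · subst hv
        cases i
        · exact .inl rfl
        · simp [dleS, copy]
      · have hv' : (u : F) ≠ v := fun h => hv (Subtype.ext h)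
        simp only [dleS, copy, hv', if_false] at hx ⊢
        exact .inr hx

/-- The congruence of `L[U]` whose nontrivial classes are the pairs `{u₀, u₁}` with `u ∈ V`. -/
def collapse (V : Set U) : LatCon (DoubledS F U) :=
  LatCon.ofOneSided (fun x y => proj x = proj y ∧ (x = y ∨ ∃ u ∈ V, proj x = (u : F)))
    { refl := fun _ => ⟨rfl, .inl rfl⟩
      symm := fun h => ⟨h.1.symm, h.2.imp Eq.symm fun ⟨u, hu, hx⟩ => ⟨u, hu, h.1 ▸ hx⟩⟩
      trans := by
        rintro x y z ⟨hxy, rfl | h⟩ ⟨hyz, rfl | h'⟩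
        · exact ⟨rfl, .inl rfl⟩
        · exact ⟨hyz, .inr h'⟩
        · exact ⟨hxy, .inr h⟩
        · exact ⟨hxy.trans hyz, .inr h⟩ }
    (by
      rintro x y z ⟨hxy, h⟩
      refine ⟨by rw [proj_sup hord, proj_sup hord, hxy], ?_⟩
      rcases eq_or_of_proj_eq hxy with rfl | ⟨u, hu, hxy'⟩
      · exact .inl rfl
      rcases h with rfl | ⟨v, hv, hx⟩
      · exact .inl rfl
      obtain rfl : u = v := Subtype.ext (hu.symm.trans hx)
      rcases (isDoublingPair_copy hord u).sup_cases z with ⟨h0, h1⟩ | hz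
      · refine .inr ⟨u, hv, ?_⟩
        rcases hxy' with ⟨rfl, rfl⟩ | ⟨rfl, rfl⟩
        · rw [h0, hx]
        · rw [h1, hx]
      · rcases hxy' with ⟨rfl, rfl⟩ | ⟨rfl, rfl⟩
        exacts [.inl hz, .inl hz.symm])
    (by
      rintro x y z ⟨hxy, h⟩
      refine ⟨by rw [proj_inf hord, proj_inf hord, hxy], ?_⟩
      rcases eq_or_of_proj_eq hxy with rfl | ⟨u, hu, hxy'⟩
      · exact .inl rfl
      rcases h with rfl | ⟨v, hv, hx⟩
      · exact .inl rfl
      obtain rfl : u = v := Subtype.ext (hu.symm.trans hx)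
      rcases (isDoublingPair_copy hord u).inf_cases z with ⟨h0, h1⟩ | hz
      · refine .inr ⟨u, hv, ?_⟩
        rcases hxy' with ⟨rfl, rfl⟩ | ⟨rfl, rfl⟩
        · rw [h0, hx]
        · rw [h1, hx]
      · rcases hxy' with ⟨rfl, rfl⟩ | ⟨rfl, rfl⟩
        exacts [.inl hz, .inl hz.symm])

theorem collapse_copy_iff {V : Set U} {u : U} :
    (collapse hord V).r (copy u false) (copy u true) ↔ u ∈ V := by
  constructor
  · rintro ⟨-, h | ⟨v, hv, h⟩⟩
    · exact absurd h (isDoublingPair_copy hord u).lt.ne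
    · obtain rfl : u = v := Subtype.ext h
      exact hv
  · exact fun hu => ⟨rfl, .inr ⟨u, hu, rfl⟩⟩

theorem collapse_le_iff {V : Set U} {c : LatCon (DoubledS F U)} :
    collapse hord V ≤ c ↔ ∀ u ∈ V, c.r (copy u false) (copy u true) := by
  refine ⟨fun h u hu => h _ _ ((collapse_copy_iff hord).2 hu), ?_⟩
  rintro h x y ⟨hxy, h'⟩
  rcases h' with rfl | ⟨v, hv, hx⟩
  · exact c.refl' x
  rcases eq_or_of_proj_eq hxy with rfl | ⟨u, hu, hxy'⟩
  · exact c.refl' x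
  obtain rfl : u = v := Subtype.ext (hu.symm.trans hx)
  rcases hxy' with ⟨rfl, rfl⟩ | ⟨rfl, rfl⟩
  exacts [h u hv, c.symm' (h u hv)]

theorem collapse_le_collapse_iff {V W : Set U} :
    collapse hord V ≤ collapse hord W ↔ V ⊆ W := by
  rw [collapse_le_iff]
  exact forall₂_congr fun u _ => collapse_copy_iff hord

theorem collapse_union (V W : Set U) :
    collapse hord (V ∪ W) = collapse hord V ⊔ collapse hord W := by
  refine eq_of_forall_ge_iff fun c => ?_
  rw [sup_le_iff, collapse_le_iff, collapse_le_iff, collapse_le_iff]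
  exact forall₂_or_left

theorem collapse_singleton (u : U) :
    collapse hord {u} = LatCon.gen (copy u false) (copy u true) := by
  refine eq_of_forall_ge_iff fun c => ?_
  rw [collapse_le_iff, LatCon.gen_le_iff]
  simp

theorem collapse_inter (V W : Set U) :
    collapse hord (V ∩ W) = collapse hord V ⊓ collapse hord W := by
  refine le_antisymm (le_inf ?_ ?_) ?_
  · exact (collapse_le_collapse_iff hord).2 Set.inter_subset_left
  · exact (collapse_le_collapse_iff hord).2 Set.inter_subset_right
  · rintro x y ⟨⟨hxy, hV⟩, -, hW⟩
    refine ⟨hxy, ?_⟩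
    rcases hV with rfl | ⟨u, hu, hx⟩
    · exact .inl rfl
    rcases hW with rfl | ⟨v, hv, hx'⟩
    · exact .inl rfl
    obtain rfl : u = v := Subtype.ext (hx.symm.trans hx')
    exact .inr ⟨u, ⟨hu, hv⟩, hx⟩

theorem eq_collapse_of_le {c : LatCon (DoubledS F U)} (hc : c ≤ collapse hord Set.univ) :
    c = collapse hord {u | c.r (copy u false) (copy u true)} := by
  refine le_antisymm (fun x y h => ?_) ((collapse_le_iff hord).2 fun u hu => hu)
  refine ⟨(hc x y h).1, ?_⟩
  rcases eq_or_of_proj_eq (hc x y h).1 with rfl | ⟨u, hu, ⟨rfl, rfl⟩ | ⟨rfl, rfl⟩⟩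
  exacts [.inl rfl, .inr ⟨u, h, hu⟩, .inr ⟨u, c.symm' h, hu⟩]

theorem collapse_ne_top [Nontrivial F] (V : Set U) : collapse hord V ≠ ⊤ := by
  intro h
  obtain ⟨x, y, hxy⟩ := exists_pair_ne F
  have : (collapse hord V).r (lift false x) (lift false y) := by rw [h]; trivial
  exact hxy (by simpa [proj_lift] using this.1)

theorem collapse_univ_of_proj_eq {x y : DoubledS F U} (h : proj x = proj y) :
    (collapse hord Set.univ).r x y := by
  refine ⟨h, ?_⟩
  rcases eq_or_of_proj_eq h with rfl | ⟨u, hu, -⟩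
  exacts [.inl rfl, .inr ⟨u, trivial, hu⟩]

/-- A congruence of `L[U]` above the kernel of `proj` descends to `L`. -/
def descend (d : LatCon (DoubledS F U)) (hd : collapse hord Set.univ ≤ d) : LatCon F :=
  have ker {x y : DoubledS F U} (h : proj x = proj y) : d.r x y :=
    hd x y (collapse_univ_of_proj_eq hord h)
  { r := fun a b => d.r (lift false a) (lift false b)
    refl' := fun _ => d.refl' _
    symm' := d.symm'
    trans' := d.trans'
    sup' := fun h h' => d.trans' (ker (by simp only [proj_sup hord, proj_lift]))
      (d.trans' (d.sup' h h') (ker (by simp only [proj_sup hord, proj_lift])))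
    inf' := fun h h' => d.trans' (ker (by simp only [proj_inf hord, proj_lift]))
      (d.trans' (d.inf' h h') (ker (by simp only [proj_inf hord, proj_lift]))) }

theorem eq_or_eq_top_of_collapse_le (hF : IsSimpleLat F) {d : LatCon (DoubledS F U)}
    (hd : collapse hord Set.univ ≤ d) : d = collapse hord Set.univ ∨ d = ⊤ := by
  have lift_proj (x : DoubledS F U) : d.r x (lift false (proj x)) :=
    hd _ _ (collapse_univ_of_proj_eq hord (proj_lift false _).symm)
  rcases hF.2 (descend hord d hd) with h | h
  · refine .inl (le_antisymm (fun x y hxy => collapse_univ_of_proj_eq hord ?_) hd)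
    have : (descend hord d hd).r (proj x) (proj y) :=
      d.trans' (d.symm' (lift_proj x)) (d.trans' hxy (lift_proj y))
    rwa [h] at this
  · refine .inr (top_unique fun x y _ => ?_)
    have : (descend hord d hd).r (proj x) (proj y) := by rw [h]; trivial
    exact d.trans' (lift_proj x) (d.trans' this (d.symm' (lift_proj y)))

theorem eq_top_of_sup_gen_eq_top (hF : IsFN F) (u : U) {d : LatCon (DoubledS F U)}
    (h : d ⊔ LatCon.gen (copy u false) (copy u true) = ⊤) : d = ⊤ := by
  by_contra hd
  obtain ⟨x, hxu, hux⟩ := hF.exists_incomparable u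
  have mono {x y : DoubledS F U} (hxy : x ≤ y) : proj x ≤ proj y := by
    rw [← sup_eq_right, ← proj_sup hord, sup_eq_right.2 hxy]
  rcases LatCon.le_or_le_of_sup_gen_eq_top (isDoublingPair_copy hord u) h hd (lift false x)
    with hx | hx
  · exact hxu (proj_lift false x ▸ mono hx)
  · exact hux (proj_lift false x ▸ mono hx)

theorem eq_top_of_sup_collapse_eq_top (hF : IsFN F) {V : Set U} (hV : V.Finite)
    {c : LatCon (DoubledS F U)} (h : c ⊔ collapse hord V = ⊤) : c = ⊤ := by
  induction V, hV using Set.Finite.induction_on with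
  | empty =>
    rwa [sup_eq_left.2 ((collapse_le_iff hord).2 fun u hu => hu.elim)] at h
  | @insert u V _ _ ih =>
    refine ih (eq_top_of_sup_gen_eq_top hord hF u ?_)
    rw [← collapse_singleton hord, sup_assoc, ← collapse_union hord, Set.union_singleton, h]

theorem eq_top_or_exists_eq_collapse (hF : IsFN F) (hU : U.Finite) (c : LatCon (DoubledS F U)) :
    c = ⊤ ∨ ∃ V, c = collapse hord V := by
  have : Finite U := hU
  rcases eq_or_eq_top_of_collapse_le hord hF.2.1
    (le_sup_right : collapse hord Set.univ ≤ c ⊔ collapse hord Set.univ) with h | h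
  · exact .inr ⟨_, eq_collapse_of_le hord (sup_eq_right.1 h)⟩
  · exact .inl (eq_top_of_sup_collapse_eq_top hord hF Set.finite_univ h)

theorem genSet_eq_collapse (V : Set U) :
    LatCon.genSet ((fun u : U => (copy u false, copy u true)) '' V) = collapse hord V := by
  refine eq_of_forall_ge_iff fun c => ?_
  rw [collapse_le_iff, LatCon.genSet_le_iff, Set.forall_mem_image]

/-- The congruence lattice of `L[U]` is the powerset of `U` with a new greatest element. -/
theorem nonempty_orderIso_withTop (hF : IsFN F) (hU : U.Finite) :
    Nonempty (WithTop (Set U) ≃o LatCon (DoubledS F U)) := by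
  have := hF.1
  let f : WithTop (Set U) → LatCon (DoubledS F U) := WithTop.recTopCoe ⊤ (collapse hord)
  have hf {x y : WithTop (Set U)} : f x ≤ f y ↔ x ≤ y := by
    induction x using WithTop.recTopCoe with
    | top =>
      induction y using WithTop.recTopCoe with
      | top => exact iff_of_true le_rfl le_rfl
      | coe W =>
        refine iff_of_false (fun h => collapse_ne_top hord W (top_unique h)) ?_
        simp
    | coe V =>
      induction y using WithTop.recTopCoe with
      | top => exact iff_of_true le_top le_top
      | coe W => exact (collapse_le_collapse_iff hord).trans WithTop.coe_le_coe.symm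
  refine ⟨RelIso.ofSurjective (OrderEmbedding.ofMapLEIff f fun _ _ => hf) fun c => ?_⟩
  rcases eq_top_or_exists_eq_collapse hord hF hU c with rfl | ⟨V, rfl⟩
  exacts [⟨⊤, rfl⟩, ⟨(V : WithTop (Set U)), rfl⟩]

end DoubledS

/-! ### STATEMENT 9 -/

/-- Let `F` be an FN lattice, `n ≥ 1`, and `U ⊆ F` an antichain with `n` elements.
In the lattice `F[U]` obtained by doubling every element of `U`, with
`θ_u = gen (u₀, u₁)` and `θ[V]` the join of `{θ_u : u ∈ V}` for `V ⊆ U`: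
each `θ[V]` is a congruence of `F[U]` (namely the least congruence above every
`θ_u`, `u ∈ V`), the map `V ↦ θ[V]` is a lattice embedding of the Boolean lattice
of subsets of `U` into `Con F[U]`, and every congruence of `F[U]` is either the all
relation `⊤` or one of the `θ[V]`; hence `Con F[U] ≅ Bₙ⁺`. -/
theorem statement9 (F : Type) [Lattice F] (hF : IsFN F) (n : ℕ) (hn : 1 ≤ n)
    (U : Finset F) (hcard : U.card = n) (hanti : IsAntichain (· ≤ ·) (↑U : Set F))
    [instK : Lattice (DoubledS F (↑U : Set F))]
    (hord : ∀ x y : DoubledS F (↑U : Set F), x ≤ y ↔ dleS (↑U : Set F) x y) :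
    let K := DoubledS F (↑U : Set F)
    let θu : (↑U : Set F) → LatCon K := fun u =>
      LatCon.gen (Sum.inr (u, false)) (Sum.inr (u, true))
    let θV : Set (↑U : Set F) → LatCon K := fun V =>
      LatCon.genSet ((fun u : (↑U : Set F) =>
        ((Sum.inr (u, false) : K), (Sum.inr (u, true) : K))) '' V)
    (∀ V : Set (↑U : Set F),
      (∀ u ∈ V, θu u ≤ θV V) ∧ (∀ d : LatCon K, (∀ u ∈ V, θu u ≤ d) → θV V ≤ d)) ∧
    Function.Injective θV ∧
    (∀ V W : Set (↑U : Set F), θV V ≤ θV W ↔ V ⊆ W) ∧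
    (∀ V W : Set (↑U : Set F), θV (V ∪ W) = θV V ⊔ θV W) ∧
    (∀ V W : Set (↑U : Set F), θV (V ∩ W) = θV V ⊓ θV W) ∧
    (∀ c : LatCon K, c = ⊤ ∨ ∃ V : Set (↑U : Set F), c = θV V) ∧
    Nonempty (LatCon K ≃o WithTop (Set (Fin n))) := by
  intro K θu θV
  have hθ (V : Set (↑U : Set F)) : θV V = DoubledS.collapse hord V :=
    DoubledS.genSet_eq_collapse hord V
  have hle (V W : Set (↑U : Set F)) : θV V ≤ θV W ↔ V ⊆ W := by
    rw [hθ, hθ, DoubledS.collapse_le_collapse_iff]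
  refine ⟨fun V => ⟨fun u hu => ?_, fun d hd => ?_⟩, fun V W h => ?_, hle, fun V W => ?_,
    fun V W => ?_, fun c => ?_, ?_⟩
  · rw [hθ]
    exact LatCon.gen_le_iff.2 ((DoubledS.collapse_copy_iff hord).2 hu)
  · rw [hθ, DoubledS.collapse_le_iff]
    exact fun u hu => LatCon.gen_le_iff.1 (hd u hu)
  · exact ((hle V W).1 h.le).antisymm ((hle W V).1 h.ge)
  · rw [hθ, hθ, hθ, DoubledS.collapse_union]
  · rw [hθ, hθ, hθ, DoubledS.collapse_inter]
  · simp only [hθ]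
    exact DoubledS.eq_top_or_exists_eq_collapse hord hF U.finite_toSet c
  · obtain ⟨e⟩ := DoubledS.nonempty_orderIso_withTop hord hF U.finite_toSet
    let e' : Set (↑U : Set F) ≃o Set (Fin n) :=
      { toEquiv := Equiv.Set.congr (U.equivFinOfCardEq hcard)
        map_rel_iff' := Set.image_subset_image_iff (Equiv.injective _) }
    exact ⟨e.symm.trans e'.withTopCongr⟩
end

section
/- For every n ≥ 0 there is an infinite semidistributive lattice whose congruence lattice is isomorphic to Bₙ⁺⁺, the Boolean lattice with n atoms with two new greatest elements successively adjoined (assuming the existence of an FN lattice, i.e., a simple, infinite, semidistributive lattice, containing antichains of every finite size). -/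
/-! ### Congruences -/

namespace LatCon

variable {L : Type*} [Lattice L]

theorem sup_right (c : LatCon L) {x y : L} (h : c.r x y) (z : L) : c.r (x ⊔ z) (y ⊔ z) :=
  c.sup' h (c.refl' z)

theorem inf_right (c : LatCon L) {x y : L} (h : c.r x y) (z : L) : c.r (x ⊓ z) (y ⊓ z) :=
  c.inf' h (c.refl' z)

theorem eq_top_of_forall {c : LatCon L} (h : ∀ x y, c.r x y) : c = ⊤ := by
  ext x y
  exact ⟨fun _ => trivial, fun _ => h x y⟩

/-- Pulling back a congruence along a lattice homomorphism. -/
def comap {M : Type*} [Lattice M] (f : LatticeHom L M) (c : LatCon M) : LatCon L where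
  r x y := c.r (f x) (f y)
  refl' _ := c.refl' _
  symm' h := c.symm' h
  trans' h₁ h₂ := c.trans' h₁ h₂
  sup' h₁ h₂ := by simpa only [map_sup] using c.sup' h₁ h₂
  inf' h₁ h₂ := by simpa only [map_inf] using c.inf' h₁ h₂

/-- The equivalence relation generated by a reflexive relation compatible with translations by
`⊔` and `⊓` is a congruence. -/
def ofEqvGen (φ : L → L → Prop)
    (hsup : ∀ x y z, φ x y → φ (x ⊔ z) (y ⊔ z)) (hinf : ∀ x y z, φ x y → φ (x ⊓ z) (y ⊓ z)) :
    LatCon L where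
  r := Relation.EqvGen φ
  refl' := .refl
  symm' h := h.symm
  trans' h₁ h₂ := h₁.trans _ _ _ h₂
  sup' {x y x' y'} h₁ h₂ := by
    have key : ∀ {x y} (z), Relation.EqvGen φ x y → Relation.EqvGen φ (x ⊔ z) (y ⊔ z) := by
      intro x y z h
      induction h with
      | rel x y h => exact .rel _ _ (hsup _ _ _ h)
      | refl x => exact .refl _
      | symm x y _ ih => exact ih.symm
      | trans x y w _ _ ih₁ ih₂ => exact ih₁.trans _ _ _ ih₂
    refine (key x' h₁).trans _ _ _ ?_
    rw [sup_comm y x', sup_comm y y']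
    exact key y h₂
  inf' {x y x' y'} h₁ h₂ := by
    have key : ∀ {x y} (z), Relation.EqvGen φ x y → Relation.EqvGen φ (x ⊓ z) (y ⊓ z) := by
      intro x y z h
      induction h with
      | rel x y h => exact .rel _ _ (hinf _ _ _ h)
      | refl x => exact .refl _
      | symm x y _ ih => exact ih.symm
      | trans x y w _ _ ih₁ ih₂ => exact ih₁.trans _ _ _ ih₂
    refine (key x' h₁).trans _ _ _ ?_
    rw [inf_comm y x', inf_comm y y']
    exact key y h₂

/-- If every congruence of `L` other than `⊤` lies in the range of an order embedding avoiding `⊤`,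
then the congruence lattice is the domain of the embedding with a top adjoined. -/
theorem nonempty_orderIso_withTop {P : Type*} [PartialOrder P] (f : P ↪o LatCon L)
    (hf : ∀ p, f p ≠ ⊤) (hr : ∀ c : LatCon L, c = ⊤ ∨ ∃ p, f p = c) :
    Nonempty (LatCon L ≃o WithTop P) := by
  let g : WithTop P → LatCon L := fun p => p.recTopCoe ⊤ f
  have hg : ∀ p q, g p ≤ g q ↔ p ≤ q := by
    intro p q
    induction p using WithTop.recTopCoe with
    | top =>
      induction q using WithTop.recTopCoe with
      | top => simp
      | coe q => simp [g, top_le_iff, hf q]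
    | coe p =>
      induction q using WithTop.recTopCoe with
      | top => simp [g]
      | coe q => simp [g]
  have hs : Function.Surjective g := by
    intro c
    rcases hr c with rfl | ⟨p, rfl⟩
    · exact ⟨⊤, rfl⟩
    · exact ⟨p, rfl⟩
  exact ⟨(RelIso.ofSurjective (OrderEmbedding.ofMapLEIff g hg) hs).symm⟩

end LatCon

/-! ### Semidistributivity of derived lattices -/

theorem SD.of_distribLattice (L : Type*) [DistribLattice L] : SD L := by
  refine ⟨fun u x y z h₁ h₂ => ?_, fun w x y z h₁ h₂ => ?_⟩
  · rw [sup_inf_left, ← h₁, ← h₂, inf_idem]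
  · rw [inf_sup_left, ← h₁, ← h₂, sup_idem]

theorem SD.pi {ι : Type*} {L : ι → Type*} [∀ i, Lattice (L i)] (h : ∀ i, SD (L i)) :
    SD (∀ i, L i) :=
  ⟨fun _ _ _ _ h₁ h₂ => funext fun i => (h i).1 _ _ _ _ (congrFun h₁ i) (congrFun h₂ i),
    fun _ _ _ _ h₁ h₂ => funext fun i => (h i).2 _ _ _ _ (congrFun h₁ i) (congrFun h₂ i)⟩

theorem SD.orderDual {L : Type*} [Lattice L] (h : SD L) : SD Lᵒᵈ :=
  ⟨fun u x y z => h.2 u.ofDual x.ofDual y.ofDual z.ofDual,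
    fun u x y z => h.1 u.ofDual x.ofDual y.ofDual z.ofDual⟩

theorem SD.withBot {L : Type*} [Lattice L] (h : SD L) : SD (WithBot L) := by
  constructor
  · intro u x y z h₁ h₂
    subst h₁
    induction x using WithBot.recBotCoe with
    | bot => simp_all
    | coe x =>
    induction y using WithBot.recBotCoe with
    | bot => simp
    | coe y =>
    induction z using WithBot.recBotCoe with
    | bot => simpa using h₂
    | coe z => exact_mod_cast h.1 _ x y z rfl (by exact_mod_cast h₂)
  · intro u x y z h₁ h₂
    subst h₁
    induction x using WithBot.recBotCoe with
    | bot => simp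
    | coe x =>
    induction y using WithBot.recBotCoe with
    | bot => simpa using h₂
    | coe y =>
    induction z using WithBot.recBotCoe with
    | bot => simp
    | coe z => exact_mod_cast h.2 _ x y z rfl (by exact_mod_cast h₂)

theorem IsSimpleLat.orderDual {L : Type*} [Lattice L] (h : IsSimpleLat L) :
    IsSimpleLat Lᵒᵈ := by
  obtain ⟨⟨x, y, hxy⟩, hc⟩ := h
  refine ⟨⟨OrderDual.toDual x, OrderDual.toDual y, hxy⟩, fun c => ?_⟩
  let d : LatCon L :=
    { r := fun x y => c.r (OrderDual.toDual x) (OrderDual.toDual y)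
      refl' := fun _ => c.refl' _
      symm' := fun h => c.symm' h
      trans' := fun h₁ h₂ => c.trans' h₁ h₂
      sup' := fun h₁ h₂ => c.inf' h₁ h₂
      inf' := fun h₁ h₂ => c.sup' h₁ h₂ }
  have hd : ∀ x y : L, d.r x y ↔ c.r (OrderDual.toDual x) (OrderDual.toDual y) :=
    fun _ _ => Iff.rfl
  rcases hc d with h | h
  · left
    ext x y
    rw [← OrderDual.toDual_ofDual x, ← OrderDual.toDual_ofDual y, ← hd, h]
    rfl
  · right
    refine LatCon.eq_top_of_forall fun x y => ?_
    rw [← OrderDual.toDual_ofDual x, ← OrderDual.toDual_ofDual y, ← hd, h]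
    trivial

theorem IsFN.orderDual {L : Type*} [Lattice L] (h : IsFN L) : IsFN Lᵒᵈ :=
  ⟨have := h.1; inferInstanceAs (Infinite L), h.2.1.orderDual, h.2.2.orderDual⟩

/-! ### Lexicographic sums of bounded lattices over a lattice -/

/-- The lexicographic sum: each point `x` of `F` is replaced by a copy of `K x`. -/
structure LexSum {F : Type*} (K : F → Type*) where
  fst : F
  snd : K fst

namespace LexSum

variable {F : Type*} [Lattice F] {K : F → Type*} [∀ x, Lattice (K x)]

/-- The lexicographic order. -/
inductive Le : LexSum K → LexSum K → Prop
  | of_lt {x y : F} (a : K x) (b : K y) : x < y → Le ⟨x, a⟩ ⟨y, b⟩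
  | of_le {x : F} {a b : K x} : a ≤ b → Le ⟨x, a⟩ ⟨x, b⟩

instance : PartialOrder (LexSum K) where
  le := Le
  le_refl s := .of_le le_rfl
  le_trans s t u h₁ h₂ := by
    cases h₁ with
    | of_lt a b h =>
      cases h₂ with
      | of_lt _ c h' => exact .of_lt _ _ (h.trans h')
      | of_le h' => exact .of_lt _ _ h
    | of_le h =>
      cases h₂ with
      | of_lt _ c h' => exact .of_lt _ _ h'
      | of_le h' => exact .of_le (h.trans h')
  le_antisymm s t h₁ h₂ := by
    cases h₁ with
    | of_lt a b h =>
      cases h₂ with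
      | of_lt _ _ h' => exact absurd h' h.not_gt
      | of_le h' => exact absurd h (lt_irrefl _)
    | of_le h =>
      cases h₂ with
      | of_lt _ _ h' => exact absurd h' (lt_irrefl _)
      | of_le h' => rw [h.antisymm h']

theorem mk_le_mk {x : F} {a b : K x} : (⟨x, a⟩ : LexSum K) ≤ ⟨x, b⟩ ↔ a ≤ b := by
  refine ⟨fun h => ?_, .of_le⟩
  cases h with
  | of_lt _ _ h => exact absurd h (lt_irrefl _)
  | of_le h => exact h

theorem mk_le_of_lt {x y : F} (h : x < y) (a : K x) (b : K y) :
    (⟨x, a⟩ : LexSum K) ≤ ⟨y, b⟩ := .of_lt a b h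

theorem lt_of_fst_lt {s t : LexSum K} (h : s.fst < t.fst) : s < t :=
  (mk_le_of_lt h s.snd t.snd).lt_of_ne fun e => h.ne (congrArg fst e)

theorem fst_le {s t : LexSum K} (h : s ≤ t) : s.fst ≤ t.fst := by
  cases h with
  | of_lt _ _ h => exact h.le
  | of_le h => exact le_rfl

/-- The four ways two points of the base can be related. -/
theorem base_cases (x y : F) : x = y ∨ x < y ∨ y < x ∨ (¬ x ≤ y ∧ ¬ y ≤ x) := by
  by_cases h₁ : x ≤ y <;> by_cases h₂ : y ≤ x <;> grind [lt_iff_le_not_ge]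

variable [∀ x, BoundedOrder (K x)]

open Classical in
noncomputable instance : Max (LexSum K) where
  max s t :=
    if h : s.fst = t.fst then ⟨t.fst, (h ▸ s.snd) ⊔ t.snd⟩
    else if s.fst ≤ t.fst then t
    else if t.fst ≤ s.fst then s
    else ⟨s.fst ⊔ t.fst, ⊥⟩

open Classical in
noncomputable instance : Min (LexSum K) where
  min s t :=
    if h : s.fst = t.fst then ⟨t.fst, (h ▸ s.snd) ⊓ t.snd⟩
    else if s.fst ≤ t.fst then s
    else if t.fst ≤ s.fst then t
    else ⟨s.fst ⊓ t.fst, ⊤⟩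

theorem max_same {x : F} (a b : K x) :
    max (⟨x, a⟩ : LexSum K) ⟨x, b⟩ = ⟨x, a ⊔ b⟩ := dif_pos rfl

theorem min_same {x : F} (a b : K x) :
    min (⟨x, a⟩ : LexSum K) ⟨x, b⟩ = ⟨x, a ⊓ b⟩ := dif_pos rfl

theorem max_of_lt {x y : F} (h : x < y) (a : K x) (b : K y) :
    max (⟨x, a⟩ : LexSum K) ⟨y, b⟩ = ⟨y, b⟩ :=
  (dif_neg h.ne).trans (if_pos h.le)

theorem min_of_lt {x y : F} (h : x < y) (a : K x) (b : K y) :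
    min (⟨x, a⟩ : LexSum K) ⟨y, b⟩ = ⟨x, a⟩ :=
  (dif_neg h.ne).trans (if_pos h.le)

theorem max_of_gt {x y : F} (h : y < x) (a : K x) (b : K y) :
    max (⟨x, a⟩ : LexSum K) ⟨y, b⟩ = ⟨x, a⟩ :=
  (dif_neg h.ne').trans ((if_neg h.not_ge).trans (if_pos h.le))

theorem min_of_gt {x y : F} (h : y < x) (a : K x) (b : K y) :
    min (⟨x, a⟩ : LexSum K) ⟨y, b⟩ = ⟨y, b⟩ :=
  (dif_neg h.ne').trans ((if_neg h.not_ge).trans (if_pos h.le))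

theorem max_of_incomp {x y : F} (h₁ : ¬ x ≤ y) (h₂ : ¬ y ≤ x) (a : K x) (b : K y) :
    max (⟨x, a⟩ : LexSum K) ⟨y, b⟩ = ⟨x ⊔ y, ⊥⟩ :=
  (dif_neg fun h => h₁ h.le).trans ((if_neg h₁).trans (if_neg h₂))

theorem min_of_incomp {x y : F} (h₁ : ¬ x ≤ y) (h₂ : ¬ y ≤ x) (a : K x) (b : K y) :
    min (⟨x, a⟩ : LexSum K) ⟨y, b⟩ = ⟨x ⊓ y, ⊤⟩ :=
  (dif_neg fun h => h₁ h.le).trans ((if_neg h₁).trans (if_neg h₂))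

theorem bot_le_mk {x y : F} (h : x ≤ y) (b : K y) : (⟨x, ⊥⟩ : LexSum K) ≤ ⟨y, b⟩ := by
  rcases h.eq_or_lt with rfl | h
  · exact mk_le_mk.2 bot_le
  · exact mk_le_of_lt h _ _

theorem mk_le_top {x y : F} (h : x ≤ y) (a : K x) : (⟨x, a⟩ : LexSum K) ≤ ⟨y, ⊤⟩ := by
  rcases h.eq_or_lt with rfl | h
  · exact mk_le_mk.2 le_top
  · exact mk_le_of_lt h _ _

noncomputable instance : Lattice (LexSum K) where
  sup := max
  inf := min
  le_sup_left := by
    rintro ⟨x, a⟩ ⟨y, b⟩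
    rcases base_cases x y with rfl | h | h | ⟨h₁, h₂⟩
    · rw [max_same]; exact mk_le_mk.2 le_sup_left
    · rw [max_of_lt h]; exact mk_le_of_lt h _ _
    · rw [max_of_gt h]
    · rw [max_of_incomp h₁ h₂]; exact mk_le_of_lt (left_lt_sup.2 h₂) _ _
  le_sup_right := by
    rintro ⟨x, a⟩ ⟨y, b⟩
    rcases base_cases x y with rfl | h | h | ⟨h₁, h₂⟩
    · rw [max_same]; exact mk_le_mk.2 le_sup_right
    · rw [max_of_lt h]
    · rw [max_of_gt h]; exact mk_le_of_lt h _ _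
    · rw [max_of_incomp h₁ h₂]; exact mk_le_of_lt (right_lt_sup.2 h₁) _ _
  sup_le := by
    rintro ⟨x, a⟩ ⟨y, b⟩ ⟨z, c⟩ hx hy
    rcases base_cases x y with rfl | h | h | ⟨h₁, h₂⟩
    · rw [max_same]
      cases hx with
      | of_lt _ _ h => exact mk_le_of_lt h _ _
      | of_le h => exact mk_le_mk.2 (sup_le h (mk_le_mk.1 hy))
    · rwa [max_of_lt h]
    · rwa [max_of_gt h]
    · rw [max_of_incomp h₁ h₂]; exact bot_le_mk (sup_le (fst_le hx) (fst_le hy)) _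
  inf_le_left := by
    rintro ⟨x, a⟩ ⟨y, b⟩
    rcases base_cases x y with rfl | h | h | ⟨h₁, h₂⟩
    · rw [min_same]; exact mk_le_mk.2 inf_le_left
    · rw [min_of_lt h]
    · rw [min_of_gt h]; exact mk_le_of_lt h _ _
    · rw [min_of_incomp h₁ h₂]; exact mk_le_of_lt (inf_lt_left.2 h₁) _ _
  inf_le_right := by
    rintro ⟨x, a⟩ ⟨y, b⟩
    rcases base_cases x y with rfl | h | h | ⟨h₁, h₂⟩
    · rw [min_same]; exact mk_le_mk.2 inf_le_right
    · rw [min_of_lt h]; exact mk_le_of_lt h _ _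
    · rw [min_of_gt h]
    · rw [min_of_incomp h₁ h₂]; exact mk_le_of_lt (inf_lt_right.2 h₂) _ _
  le_inf := by
    rintro ⟨z, c⟩ ⟨x, a⟩ ⟨y, b⟩ hx hy
    rcases base_cases x y with rfl | h | h | ⟨h₁, h₂⟩
    · rw [min_same]
      cases hx with
      | of_lt _ _ h => exact mk_le_of_lt h _ _
      | of_le h => exact mk_le_mk.2 (le_inf h (mk_le_mk.1 hy))
    · rwa [min_of_lt h]
    · rwa [min_of_gt h]
    · rw [min_of_incomp h₁ h₂]; exact mk_le_top (le_inf (fst_le hx) (fst_le hy)) _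

theorem sup_same {x : F} (a b : K x) :
    (⟨x, a⟩ : LexSum K) ⊔ ⟨x, b⟩ = ⟨x, a ⊔ b⟩ := max_same a b

theorem inf_same {x : F} (a b : K x) :
    (⟨x, a⟩ : LexSum K) ⊓ ⟨x, b⟩ = ⟨x, a ⊓ b⟩ := min_same a b

theorem sup_of_lt {x y : F} (h : x < y) (a : K x) (b : K y) :
    (⟨x, a⟩ : LexSum K) ⊔ ⟨y, b⟩ = ⟨y, b⟩ := max_of_lt h a b

theorem inf_of_lt {x y : F} (h : x < y) (a : K x) (b : K y) :
    (⟨x, a⟩ : LexSum K) ⊓ ⟨y, b⟩ = ⟨x, a⟩ := min_of_lt h a b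

theorem sup_of_gt {x y : F} (h : y < x) (a : K x) (b : K y) :
    (⟨x, a⟩ : LexSum K) ⊔ ⟨y, b⟩ = ⟨x, a⟩ := max_of_gt h a b

theorem inf_of_gt {x y : F} (h : y < x) (a : K x) (b : K y) :
    (⟨x, a⟩ : LexSum K) ⊓ ⟨y, b⟩ = ⟨y, b⟩ := min_of_gt h a b

theorem sup_of_incomp {x y : F} (h₁ : ¬ x ≤ y) (h₂ : ¬ y ≤ x) (a : K x) (b : K y) :
    (⟨x, a⟩ : LexSum K) ⊔ ⟨y, b⟩ = ⟨x ⊔ y, ⊥⟩ := max_of_incomp h₁ h₂ a b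

theorem inf_of_incomp {x y : F} (h₁ : ¬ x ≤ y) (h₂ : ¬ y ≤ x) (a : K x) (b : K y) :
    (⟨x, a⟩ : LexSum K) ⊓ ⟨y, b⟩ = ⟨x ⊓ y, ⊤⟩ := min_of_incomp h₁ h₂ a b

@[simp]
theorem fst_sup (s t : LexSum K) : (s ⊔ t).fst = s.fst ⊔ t.fst := by
  obtain ⟨x, a⟩ := s
  obtain ⟨y, b⟩ := t
  rcases base_cases x y with rfl | h | h | ⟨h₁, h₂⟩
  · simp [sup_same]
  · simp [sup_of_lt h, h.le]
  · simp [sup_of_gt h, h.le]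
  · rw [sup_of_incomp h₁ h₂]

@[simp]
theorem fst_inf (s t : LexSum K) : (s ⊓ t).fst = s.fst ⊓ t.fst := by
  obtain ⟨x, a⟩ := s
  obtain ⟨y, b⟩ := t
  rcases base_cases x y with rfl | h | h | ⟨h₁, h₂⟩
  · simp [inf_same]
  · simp [inf_of_lt h, h.le]
  · simp [inf_of_gt h, h.le]
  · rw [inf_of_incomp h₁ h₂]

noncomputable instance [BoundedOrder F] : BoundedOrder (LexSum K) where
  top := ⟨⊤, ⊤⟩
  bot := ⟨⊥, ⊥⟩
  le_top _ := mk_le_top le_top _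
  bot_le _ := bot_le_mk bot_le _

instance [Infinite F] : Infinite (LexSum K) :=
  .of_injective (fun x => (⟨x, ⊥⟩ : LexSum K)) fun _ _ h => congrArg fst h

/-! #### Semidistributivity -/

/-- A join whose base point differs from those of both joinands is the bottom of its fibre. -/
theorem sup_eq_bot {s t : LexSum K} (h₁ : s.fst ⊔ t.fst ≠ s.fst) (h₂ : s.fst ⊔ t.fst ≠ t.fst) :
    s ⊔ t = ⟨s.fst ⊔ t.fst, ⊥⟩ :=
  sup_of_incomp (mt sup_eq_right.2 h₂) (mt sup_eq_left.2 h₁) _ _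

theorem inf_eq_top {s t : LexSum K} (h₁ : s.fst ⊓ t.fst ≠ s.fst) (h₂ : s.fst ⊓ t.fst ≠ t.fst) :
    s ⊓ t = ⟨s.fst ⊓ t.fst, ⊤⟩ :=
  inf_of_incomp (mt inf_eq_left.2 h₁) (mt inf_eq_right.2 h₂) _ _

theorem joinSD (hF : JoinSD F) (hK : ∀ x, JoinSD (K x)) : JoinSD (LexSum K) := by
  rintro u s t v rfl h
  have hf := congrArg fst h
  simp only [fst_sup] at hf
  have hf' : s.fst ⊔ t.fst = s.fst ⊔ (t.fst ⊓ v.fst) := hF _ _ _ _ rfl hf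
  by_cases hs : s.fst ⊔ t.fst = s.fst
  · have ht : t.fst ≤ s.fst := sup_eq_left.1 hs
    have hv : v.fst ≤ s.fst := sup_eq_left.1 (hf.symm.trans hs)
    rcases ht.eq_or_lt with ht | ht
    · rcases hv.eq_or_lt with hv | hv
      · obtain ⟨x, a⟩ := s
        obtain ⟨y, b⟩ := t
        obtain ⟨z, c⟩ := v
        obtain rfl : y = x := ht
        obtain rfl : z = y := hv
        simp only [sup_same, inf_same, mk.injEq, heq_eq_eq, true_and] at h ⊢
        exact hK _ _ _ _ _ rfl h
      · have := (lt_of_fst_lt hv).le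
        rw [h, sup_eq_left.2 this, sup_eq_left.2 (inf_le_right.trans this)]
    · have := (lt_of_fst_lt ht).le
      rw [sup_eq_left.2 this, sup_eq_left.2 (inf_le_left.trans this)]
  by_cases ht : s.fst ⊔ t.fst = t.fst
  · have hst : s < t := lt_of_fst_lt ((sup_eq_right.1 ht).lt_of_ne fun e => hs (by simp [e]))
    by_cases hv : s.fst ⊔ v.fst = v.fst
    · have hsv : s < v := lt_of_fst_lt ((sup_eq_right.1 hv).lt_of_ne fun e => hs (by rw [hf, ← e, sup_idem]))
      have : t = v := by rw [← sup_eq_right.2 hst.le, h, sup_eq_right.2 hsv.le]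
      simp [this]
    · have hvt : v < t := lt_of_fst_lt <| by
        rw [← ht, hf]
        exact le_sup_right.lt_of_ne (Ne.symm hv)
      rw [inf_eq_right.2 hvt.le, h]
  by_cases hv : s.fst ⊔ v.fst = v.fst
  · have htv : t < v := lt_of_fst_lt <| by
      rw [← hv, ← hf]
      exact le_sup_right.lt_of_ne (Ne.symm ht)
    rw [inf_eq_left.2 htv.le]
  have hw : s.fst ⊔ (t ⊓ v).fst ≠ (t ⊓ v).fst := by
    rw [fst_inf, ← hf']
    intro e
    exact ht (le_antisymm (e.trans_le inf_le_left) le_sup_right)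
  rw [sup_eq_bot hs ht, sup_eq_bot (by rwa [fst_inf, ← hf']) hw, fst_inf, ← hf']

theorem meetSD (hF : MeetSD F) (hK : ∀ x, MeetSD (K x)) : MeetSD (LexSum K) := by
  rintro u s t v rfl h
  have hf := congrArg fst h
  simp only [fst_inf] at hf
  have hf' : s.fst ⊓ t.fst = s.fst ⊓ (t.fst ⊔ v.fst) := hF _ _ _ _ rfl hf
  by_cases hs : s.fst ⊓ t.fst = s.fst
  · have ht : s.fst ≤ t.fst := inf_eq_left.1 hs
    have hv : s.fst ≤ v.fst := inf_eq_left.1 (hf.symm.trans hs)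
    rcases ht.eq_or_lt with ht | ht
    · rcases hv.eq_or_lt with hv | hv
      · obtain ⟨x, a⟩ := s
        obtain ⟨y, b⟩ := t
        obtain ⟨z, c⟩ := v
        obtain rfl : x = y := ht
        obtain rfl : x = z := hv
        simp only [sup_same, inf_same, mk.injEq, heq_eq_eq, true_and] at h ⊢
        exact hK _ _ _ _ _ rfl h
      · have := (lt_of_fst_lt hv).le
        rw [h, inf_eq_left.2 this, inf_eq_left.2 (this.trans le_sup_right)]
    · have := (lt_of_fst_lt ht).le
      rw [inf_eq_left.2 this, inf_eq_left.2 (this.trans le_sup_left)]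
  by_cases ht : s.fst ⊓ t.fst = t.fst
  · have hst : t < s := lt_of_fst_lt ((inf_eq_right.1 ht).lt_of_ne fun e => hs (by simp [e]))
    by_cases hv : s.fst ⊓ v.fst = v.fst
    · have hsv : v < s := lt_of_fst_lt ((inf_eq_right.1 hv).lt_of_ne fun e => hs (by rw [hf, e, inf_idem]))
      have : t = v := by rw [← inf_eq_right.2 hst.le, h, inf_eq_right.2 hsv.le]
      simp [this]
    · have hvt : t < v := lt_of_fst_lt <| by
        rw [← ht, hf]
        exact inf_le_right.lt_of_ne hv
      rw [sup_eq_right.2 hvt.le, h]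
  by_cases hv : s.fst ⊓ v.fst = v.fst
  · have htv : v < t := lt_of_fst_lt <| by
      rw [← hv, ← hf]
      exact inf_le_right.lt_of_ne ht
    rw [sup_eq_left.2 htv.le]
  have hw : s.fst ⊓ (t ⊔ v).fst ≠ (t ⊔ v).fst := by
    rw [fst_sup, ← hf']
    intro e
    exact ht (le_antisymm inf_le_right (le_sup_left.trans_eq e.symm))
  rw [inf_eq_top hs ht, inf_eq_top (by rwa [fst_sup, ← hf']) hw, fst_sup, ← hf']

theorem sd (hF : SD F) (hK : ∀ x, SD (K x)) : SD (LexSum K) :=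
  ⟨joinSD hF.1 fun x => (hK x).1, meetSD hF.2 fun x => (hK x).2⟩

/-! #### Congruences -/

/-- The congruence of the lexicographic sum given by a congruence on each fibre. -/
inductive FibreRel (c : ∀ x, LatCon (K x)) : LexSum K → LexSum K → Prop
  | mk {x : F} {a b : K x} : (c x).r a b → FibreRel c ⟨x, a⟩ ⟨x, b⟩

omit [Lattice F] [∀ x, BoundedOrder (K x)] in
theorem fibreRel_mk {c : ∀ x, LatCon (K x)} {x : F} {a b : K x} :
    FibreRel c ⟨x, a⟩ ⟨x, b⟩ ↔ (c x).r a b := by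
  refine ⟨fun h => ?_, .mk⟩
  cases h
  assumption

/-- `FibreRel` as a congruence. -/
def fibreCon (c : ∀ x, LatCon (K x)) : LatCon (LexSum K) where
  r := FibreRel c
  refl' s := .mk ((c _).refl' _)
  symm' := by
    rintro _ _ ⟨h⟩
    exact .mk ((c _).symm' h)
  trans' := by
    rintro _ _ _ ⟨h⟩ h'
    cases h' with
    | mk h' => exact .mk ((c _).trans' h h')
  sup' := by
    rintro _ _ _ _ ⟨h⟩ ⟨h'⟩
    rename_i x a b y a' b'
    rcases base_cases x y with rfl | hxy | hxy | ⟨h₁, h₂⟩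
    · rw [sup_same, sup_same]; exact .mk ((c _).sup' h h')
    · rw [sup_of_lt hxy, sup_of_lt hxy]; exact .mk h'
    · rw [sup_of_gt hxy, sup_of_gt hxy]; exact .mk h
    · rw [sup_of_incomp h₁ h₂, sup_of_incomp h₁ h₂]; exact .mk ((c _).refl' _)
  inf' := by
    rintro _ _ _ _ ⟨h⟩ ⟨h'⟩
    rename_i x a b y a' b'
    rcases base_cases x y with rfl | hxy | hxy | ⟨h₁, h₂⟩
    · rw [inf_same, inf_same]; exact .mk ((c _).inf' h h')
    · rw [inf_of_lt hxy, inf_of_lt hxy]; exact .mk h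
    · rw [inf_of_gt hxy, inf_of_gt hxy]; exact .mk h'
    · rw [inf_of_incomp h₁ h₂, inf_of_incomp h₁ h₂]; exact .mk ((c _).refl' _)

/-- The inclusion of a fibre. -/
def fibreHom (x : F) : LatticeHom (K x) (LexSum K) where
  toFun a := ⟨x, a⟩
  map_sup' a b := (sup_same a b).symm
  map_inf' a b := (inf_same a b).symm

theorem fibreCon_le_iff {c d : ∀ x, LatCon (K x)} : fibreCon c ≤ fibreCon d ↔ c ≤ d := by
  refine ⟨fun h x a b hab => fibreRel_mk.1 (h _ _ (.mk hab)), ?_⟩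
  rintro h _ _ ⟨hab⟩
  exact .mk (h _ _ _ hab)

/-- If a simple lattice is the union of the principal ideal and the principal filter of `u`, then
`u` is its bottom or top. -/
theorem isBot_or_isTop_of_forall_le_or_ge (hF : IsSimpleLat F) (u : F)
    (h : ∀ x, x ≤ u ∨ u ≤ x) : IsBot u ∨ IsTop u := by
  let c : LatCon F :=
    { r := fun x y => x = y ∨ (x ≤ u ∧ y ≤ u)
      refl' := fun _ => .inl rfl
      symm' := by grind
      trans' := by grind
      sup' := by
        have key : ∀ x y z, x ≤ u → y ≤ u → x ⊔ z = y ⊔ z ∨ (x ⊔ z ≤ u ∧ y ⊔ z ≤ u) := by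
          intro x y z hx hy
          rcases h z with hz | hz
          · exact .inr ⟨sup_le hx hz, sup_le hy hz⟩
          · left
            rw [sup_eq_right.2 (hx.trans hz), sup_eq_right.2 (hy.trans hz)]
        rintro x y x' y' (rfl | ⟨hx, hy⟩) (rfl | ⟨hx', hy'⟩)
        · exact .inl rfl
        · rw [sup_comm x, sup_comm x]; exact key _ _ _ hx' hy'
        · exact key _ _ _ hx hy
        · exact .inr ⟨sup_le hx hx', sup_le hy hy'⟩
      inf' := by
        rintro x y x' y' (rfl | ⟨hx, hy⟩) (rfl | ⟨hx', hy'⟩)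
        · exact .inl rfl
        · exact .inr ⟨inf_le_right.trans hx', inf_le_right.trans hy'⟩
        · exact .inr ⟨inf_le_left.trans hx, inf_le_left.trans hy⟩
        · exact .inr ⟨inf_le_right.trans hx', inf_le_right.trans hy'⟩ }
  rcases hF.2 c with hc | hc
  · left
    intro x
    have hr : c.r u (x ⊓ u) := .inr ⟨le_rfl, inf_le_right⟩
    rw [hc] at hr
    exact inf_eq_right.1 (Eq.symm hr)
  · right
    intro x
    have hr : c.r x u := by rw [hc]; trivial
    rcases hr with rfl | ⟨hr, -⟩
    · exact le_rfl
    · exact hr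

/-- A congruence identifying points over different base points collapses each fibre that does not
sit over a bound of the base. -/
theorem r_bot_top (hF : IsSimpleLat F) (c : LatCon (LexSum K)) {s t : LexSum K} (hst : c.r s t)
    (hne : s.fst ≠ t.fst) (u : F) (hbot : ¬ IsBot u) (htop : ¬ IsTop u) :
    c.r ⟨u, ⊥⟩ ⟨u, ⊤⟩ := by
  by_contra hu
  let d : LatCon F := .ofEqvGen (fun x y => ∃ a b, c.r ⟨x, a⟩ ⟨y, b⟩)
    (by
      rintro x y z ⟨a, b, h⟩
      have := c.sup_right h ⟨z, ⊥⟩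
      have e₁ := fst_sup (⟨x, a⟩ : LexSum K) ⟨z, ⊥⟩
      have e₂ := fst_sup (⟨y, b⟩ : LexSum K) ⟨z, ⊥⟩
      simp only at e₁ e₂
      rw [← e₁, ← e₂]
      exact ⟨_, _, this⟩)
    (by
      rintro x y z ⟨a, b, h⟩
      have := c.inf_right h ⟨z, ⊥⟩
      have e₁ := fst_inf (⟨x, a⟩ : LexSum K) ⟨z, ⊥⟩
      have e₂ := fst_inf (⟨y, b⟩ : LexSum K) ⟨z, ⊥⟩
      simp only at e₁ e₂
      rw [← e₁, ← e₂]
      exact ⟨_, _, this⟩)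
  have hd : d = ⊤ := (hF.2 d).resolve_left fun e => by
    have : d.r s.fst t.fst := .rel _ _ ⟨s.snd, t.snd, hst⟩
    rw [e] at this
    exact hne this
  -- Points over base points incomparable with `u` are only related to points of the same kind.
  have step : ∀ x y (a : K x) (b : K y), c.r ⟨x, a⟩ ⟨y, b⟩ → ¬ x ≤ u → ¬ u ≤ x →
      ¬ y ≤ u ∧ ¬ u ≤ y := by
    intro x y a b h hx₁ hx₂
    have h₁ := c.inf_right (c.sup_right h ⟨u, ⊥⟩) ⟨u, ⊤⟩
    have h₂ := c.sup_right (c.inf_right h ⟨u, ⊤⟩) ⟨u, ⊥⟩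
    rw [sup_of_incomp hx₁ hx₂, inf_of_gt (right_lt_sup.2 hx₁)] at h₁
    rw [inf_of_incomp hx₁ hx₂, sup_of_lt (inf_lt_right.2 hx₂)] at h₂
    rcases base_cases y u with rfl | hy | hy | hy
    · rw [sup_same, inf_same, sup_bot_eq, inf_top_eq] at h₁
      rw [inf_same, sup_same, sup_bot_eq, inf_top_eq] at h₂
      exact absurd (c.trans' h₂ (c.symm' h₁)) hu
    · rw [sup_of_lt hy, inf_same, inf_top_eq] at h₁
      exact absurd (c.symm' h₁) hu
    · rw [inf_of_gt hy, sup_same, sup_bot_eq] at h₂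
      exact absurd h₂ hu
    · exact hy
  have inv : ∀ x y, Relation.EqvGen (fun x y => ∃ a b, c.r ⟨x, a⟩ ⟨y, b⟩) x y →
      ((¬ x ≤ u ∧ ¬ u ≤ x) ↔ (¬ y ≤ u ∧ ¬ u ≤ y)) := by
    intro x y h
    induction h with
    | rel x y h =>
      obtain ⟨a, b, h⟩ := h
      exact ⟨fun hx => step _ _ _ _ h hx.1 hx.2, fun hy => step _ _ _ _ (c.symm' h) hy.1 hy.2⟩
    | refl x => rfl
    | symm x y _ ih => exact ih.symm
    | trans x y z _ _ ih₁ ih₂ => exact ih₁.trans ih₂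
  refine (isBot_or_isTop_of_forall_le_or_ge hF u fun x => ?_).elim hbot htop
  have hx : d.r x u := by rw [hd]; trivial
  have := inv x u hx
  grind

theorem eq_top_of_r (hF : IsSimpleLat F) (hK : ∀ x, Nontrivial (K x) → ¬ IsBot x ∧ ¬ IsTop x)
    (c : LatCon (LexSum K)) {s t : LexSum K} (hst : c.r s t) (hne : s.fst ≠ t.fst) : c = ⊤ := by
  have hfib : ∀ x (a b : K x), c.r ⟨x, a⟩ ⟨x, b⟩ := by
    intro x a b
    rcases subsingleton_or_nontrivial (K x) with h | h
    · rw [Subsingleton.elim a b]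
      exact c.refl' _
    · have hx := r_bot_top hF c hst hne x (hK x h).1 (hK x h).2
      have key : ∀ a : K x, c.r ⟨x, ⊥⟩ ⟨x, a⟩ := fun a => by
        simpa [inf_same] using c.inf_right hx ⟨x, a⟩
      exact c.trans' (c.symm' (key a)) (key b)
  let d : LatCon F :=
    { r := fun x y => c.r ⟨x, ⊥⟩ ⟨y, ⊥⟩
      refl' := fun _ => c.refl' _
      symm' := fun h => c.symm' h
      trans' := fun h₁ h₂ => c.trans' h₁ h₂
      sup' := fun {x y x' y'} h₁ h₂ => by
        have key : ∀ x y : F, c.r ⟨x ⊔ y, ⊥⟩ (⟨x, ⊥⟩ ⊔ ⟨y, ⊥⟩) := fun x y => by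
          rw [← fst_sup (⟨x, ⊥⟩ : LexSum K) ⟨y, ⊥⟩]
          exact hfib _ _ _
        exact c.trans' (key _ _) (c.trans' (c.sup' h₁ h₂) (c.symm' (key _ _)))
      inf' := fun {x y x' y'} h₁ h₂ => by
        have key : ∀ x y : F, c.r ⟨x ⊓ y, ⊥⟩ (⟨x, ⊥⟩ ⊓ ⟨y, ⊥⟩) := fun x y => by
          rw [← fst_inf (⟨x, ⊥⟩ : LexSum K) ⟨y, ⊥⟩]
          exact hfib _ _ _
        exact c.trans' (key _ _) (c.trans' (c.inf' h₁ h₂) (c.symm' (key _ _))) }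
  have hd : d = ⊤ := (hF.2 d).resolve_left fun e => by
    have : d.r s.fst t.fst := c.trans' (hfib _ _ s.snd) (c.trans' hst (hfib _ _ _))
    rw [e] at this
    exact hne this
  refine LatCon.eq_top_of_forall fun x y => ?_
  have : d.r x.fst y.fst := by rw [hd]; trivial
  exact c.trans' (hfib _ x.snd _) (c.trans' this (hfib _ _ y.snd))

/-- The congruence lattice of a lexicographic sum over a simple lattice. -/
theorem nonempty_latCon_orderIso (hF : IsSimpleLat F)
    (hK : ∀ x, Nontrivial (K x) → ¬ IsBot x ∧ ¬ IsTop x) :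
    Nonempty (LatCon (LexSum K) ≃o WithTop (∀ x, LatCon (K x))) := by
  refine LatCon.nonempty_orderIso_withTop
    (OrderEmbedding.ofMapLEIff fibreCon fun _ _ => fibreCon_le_iff) (fun c hc => ?_) fun c => ?_
  · obtain ⟨x, y, hxy⟩ := hF.1
    have : (fibreCon c).r ⟨x, ⊥⟩ ⟨y, ⊥⟩ := by
      change fibreCon c = ⊤ at hc
      rw [hc]
      trivial
    cases this
    exact hxy rfl
  · refine or_iff_not_imp_left.2 fun hc => ⟨fun x => c.comap (fibreHom x), ?_⟩
    ext s t
    constructor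
    · rintro ⟨h⟩
      exact h
    · intro h
      obtain ⟨x, a⟩ := s
      obtain ⟨y, b⟩ := t
      by_cases hxy : x = y
      · subst hxy
        exact .mk h
      · exact absurd (eq_top_of_r hF hK c h hxy) hc

end LexSum

/-! ### Replacing the points of a set by copies of a lattice -/

/-- The lattice obtained from `F` by replacing each point of `U` by a copy of `L`. -/
abbrev Inflate {F : Type*} (U : Set F) (L : Type*) : Type _ :=
  LexSum fun x : F => PLift (x ∈ U) → L

namespace Inflate

variable {F : Type*} [Lattice F] {U : Set F} {L : Type*} [Lattice L] [BoundedOrder L]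

theorem sd (hF : SD F) (hL : SD L) : SD (Inflate U L) :=
  LexSum.sd hF fun _ => SD.pi fun _ => hL

omit [Lattice L] [BoundedOrder L] in
theorem not_isBot_and_not_isTop (hU : ∀ x ∈ U, ¬ IsBot x ∧ ¬ IsTop x) (x : F)
    (h : Nontrivial (PLift (x ∈ U) → L)) : ¬ IsBot x ∧ ¬ IsTop x := by
  refine hU x ?_
  by_contra hx
  have : IsEmpty (PLift (x ∈ U)) := ⟨fun p => hx p.down⟩
  exact not_subsingleton (PLift (x ∈ U) → L) inferInstance

/-- The embedding of `L` into `ι → L` by constant functions. -/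
def constHom (ι L : Type*) [Lattice L] : LatticeHom L (ι → L) where
  toFun a _ := a
  map_sup' _ _ := rfl
  map_inf' _ _ := rfl

/-- Congruences on the fibres amount to congruences of `L` indexed by `U`. -/
def fibreConIso (U : Set F) (L : Type*) [Lattice L] :
    (∀ x, LatCon (PLift (x ∈ U) → L)) ≃o (U → LatCon L) where
  toFun c x := (c x).comap (constHom _ _)
  invFun c x :=
    { r := fun a b => ∀ h : PLift (x ∈ U), (c ⟨x, h.down⟩).r (a h) (b h)
      refl' := fun _ _ => LatCon.refl' _ _
      symm' := fun h p => LatCon.symm' _ (h p)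
      trans' := fun h₁ h₂ p => LatCon.trans' _ (h₁ p) (h₂ p)
      sup' := fun h₁ h₂ p => LatCon.sup' _ (h₁ p) (h₂ p)
      inf' := fun h₁ h₂ p => LatCon.inf' _ (h₁ p) (h₂ p) }
  left_inv c := by
    funext x
    ext a b
    by_cases hx : x ∈ U
    · have key : ∀ a : PLift (x ∈ U) → L, constHom _ _ (a ⟨hx⟩) = a := fun _ => rfl
      exact ⟨fun h => key a ▸ key b ▸ h ⟨hx⟩, fun h _ => by
        change (c x).r _ _
        rwa [key, key]⟩
    · have : IsEmpty (PLift (x ∈ U)) := ⟨fun p => hx p.down⟩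
      refine ⟨fun _ => ?_, fun _ p => isEmptyElim p⟩
      rw [Subsingleton.elim a b]
      exact (c x).refl' _
  right_inv c := by
    funext x
    ext a b
    exact ⟨fun h => h ⟨x.2⟩, fun h _ => h⟩
  map_rel_iff' {c d} := by
    refine ⟨fun h x a b hab => ?_, fun h x a b hab => h _ _ _ hab⟩
    by_cases hx : x ∈ U
    · exact h ⟨x, hx⟩ (a ⟨hx⟩) (b ⟨hx⟩) hab
    · have : IsEmpty (PLift (x ∈ U)) := ⟨fun p => hx p.down⟩
      rw [Subsingleton.elim a b]
      exact (d x).refl' _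

theorem nonempty_latCon_orderIso (hF : IsSimpleLat F) (hU : ∀ x ∈ U, ¬ IsBot x ∧ ¬ IsTop x) :
    Nonempty (LatCon (Inflate U L) ≃o WithTop (U → LatCon L)) := by
  obtain ⟨e⟩ := LexSum.nonempty_latCon_orderIso hF (not_isBot_and_not_isTop (L := L) hU)
  exact ⟨e.trans (fibreConIso U L).withTopCongr⟩

end Inflate

/-- The two-element lattice has two congruences. -/
theorem LatCon.nonempty_orderIso_prop : Nonempty (LatCon Prop ≃o Prop) := by
  let f : LatCon Prop → Prop := fun c => c.r False True
  have key : ∀ c : LatCon Prop, c.r False True → ∀ x y, c.r x y := by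
    intro c h x y
    have h' := c.symm' h
    by_cases hx : x <;> by_cases hy : y <;> simp [hx, hy, h, h', c.refl']
  have hf : ∀ c d, f c ≤ f d ↔ c ≤ d := by
    refine fun c d => ⟨fun h x y hxy => ?_, fun h => h _ _⟩
    by_cases e : x = y
    · rw [e]
      exact d.refl' y
    · refine key d (h ?_) x y
      by_cases hx : x <;> by_cases hy : y <;> simp_all [f]
      exact c.symm' hxy
  refine ⟨RelIso.ofSurjective (OrderEmbedding.ofMapLEIff f hf) fun p => ?_⟩
  by_cases hp : p
  · exact ⟨⊤, by simp only [hp]; exact eq_true trivial⟩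
  · refine ⟨⊥, ?_⟩
    simp only [hp]
    exact eq_false false_ne_true

/-! ### Adjoining a least element -/

/-- Extension of a congruence to the lattice with a new least element, which forms a singleton
class. -/
def LatCon.withBot {L : Type*} [Lattice L] (c : LatCon L) : LatCon (WithBot L) where
  r x y := (x = ⊥ ∧ y = ⊥) ∨ ∃ a b : L, x = a ∧ y = b ∧ c.r a b
  refl' x := by
    induction x using WithBot.recBotCoe with
    | bot => exact .inl ⟨rfl, rfl⟩
    | coe x => exact .inr ⟨x, x, rfl, rfl, c.refl' x⟩
  symm' := by
    rintro x y (⟨rfl, rfl⟩ | ⟨a, b, rfl, rfl, h⟩)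
    · exact .inl ⟨rfl, rfl⟩
    · exact .inr ⟨b, a, rfl, rfl, c.symm' h⟩
  trans' := by
    rintro x y z (⟨rfl, rfl⟩ | ⟨a, b, rfl, rfl, h⟩) h'
    · exact h'
    · rcases h' with ⟨h', -⟩ | ⟨a', b', h₁, rfl, h'⟩
      · exact absurd h' WithBot.coe_ne_bot
      · obtain rfl := WithBot.coe_injective h₁
        exact .inr ⟨_, _, rfl, rfl, c.trans' h h'⟩
  sup' := by
    rintro x y x' y' (⟨rfl, rfl⟩ | ⟨a, b, rfl, rfl, h⟩) (⟨rfl, rfl⟩ | ⟨a', b', rfl, rfl, h'⟩)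
    · exact .inl ⟨bot_sup_eq _, bot_sup_eq _⟩
    · exact .inr ⟨a', b', bot_sup_eq _, bot_sup_eq _, h'⟩
    · exact .inr ⟨a, b, sup_bot_eq _, sup_bot_eq _, h⟩
    · exact .inr ⟨_, _, (WithBot.coe_sup _ _).symm, (WithBot.coe_sup _ _).symm, c.sup' h h'⟩
  inf' := by
    rintro x y x' y' (⟨rfl, rfl⟩ | ⟨a, b, rfl, rfl, h⟩) (⟨rfl, rfl⟩ | ⟨a', b', rfl, rfl, h'⟩)
    · exact .inl ⟨bot_inf_eq _, bot_inf_eq _⟩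
    · exact .inl ⟨bot_inf_eq _, bot_inf_eq _⟩
    · exact .inl ⟨inf_bot_eq _, inf_bot_eq _⟩
    · exact .inr ⟨_, _, (WithBot.coe_inf _ _).symm, (WithBot.coe_inf _ _).symm, c.inf' h h'⟩

theorem LatCon.withBot_r_coe {L : Type*} [Lattice L] {c : LatCon L} {a b : L} :
    c.withBot.r a b ↔ c.r a b := by
  constructor
  · rintro (⟨h, -⟩ | ⟨a', b', h₁, h₂, h⟩)
    · exact absurd h WithBot.coe_ne_bot
    · rwa [WithBot.coe_injective h₁, WithBot.coe_injective h₂]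
  · exact fun h => .inr ⟨a, b, rfl, rfl, h⟩

/-- If the only congruence collapsing a principal ideal of `L` is `⊤`, then adjoining a new least
element to `L` adjoins a new greatest element to its congruence lattice. -/
theorem LatCon.nonempty_withBot_orderIso {L : Type*} [Lattice L] [Nonempty L]
    (h : ∀ (c : LatCon L) (x : L), (∀ y ≤ x, c.r y x) → c = ⊤) :
    Nonempty (LatCon (WithBot L) ≃o WithTop (LatCon L)) := by
  let i : LatticeHom L (WithBot L) :=
    { toFun := fun a => a, map_sup' := fun _ _ => rfl, map_inf' := fun _ _ => rfl }
  refine nonempty_orderIso_withTop (OrderEmbedding.ofMapLEIff withBot fun c d => ?_)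
    (fun c hc => ?_) fun c => ?_
  · constructor
    · exact fun hcd a b hab => withBot_r_coe.1 (hcd _ _ (withBot_r_coe.2 hab))
    · rintro hcd _ _ (⟨rfl, rfl⟩ | ⟨a, b, rfl, rfl, hab⟩)
      · exact refl' _ _
      · exact withBot_r_coe.2 (hcd _ _ hab)
  · obtain ⟨x⟩ := ‹Nonempty L›
    have : c.withBot.r ⊥ x := by
      change c.withBot = ⊤ at hc
      rw [hc]
      trivial
    rcases this with ⟨-, h⟩ | ⟨a, b, h, -, -⟩
    · exact WithBot.coe_ne_bot h
    · exact WithBot.coe_ne_bot h.symm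
  · by_cases hb : ∃ x : L, c.r ⊥ x
    · left
      obtain ⟨x, hx⟩ := hb
      have hbot : ∀ y ≤ x, c.r ⊥ y := fun y hy => by
        have := c.inf_right hx (y : WithBot L)
        rwa [bot_inf_eq, inf_eq_right.2 (WithBot.coe_le_coe.2 hy)] at this
      have hc : c.comap i = ⊤ := h _ x fun y hy => c.trans' (c.symm' (hbot y hy)) hx
      have hall : ∀ a b : L, c.r a b := fun a b => by
        have : (c.comap i).r a b := by rw [hc]; trivial
        exact this
      have hbot' : ∀ y, c.r ⊥ y := fun y => by
        induction y using WithBot.recBotCoe with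
        | bot => exact c.refl' _
        | coe y => exact c.trans' hx (hall x y)
      exact eq_top_of_forall fun a b => c.trans' (c.symm' (hbot' a)) (hbot' b)
    · right
      refine ⟨c.comap i, ?_⟩
      ext x y
      change (c.comap i).withBot.r x y ↔ _
      induction x using WithBot.recBotCoe with
      | bot =>
        induction y using WithBot.recBotCoe with
        | bot => exact iff_of_true (refl' _ _) (refl' _ _)
        | coe y =>
          refine iff_of_false ?_ fun h => hb ⟨y, h⟩
          rintro (⟨-, h⟩ | ⟨a, b, h, -, -⟩)
          · exact WithBot.coe_ne_bot h
          · exact WithBot.coe_ne_bot h.symm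
      | coe x =>
        induction y using WithBot.recBotCoe with
        | bot =>
          refine iff_of_false ?_ fun h => hb ⟨x, c.symm' h⟩
          rintro (⟨h, -⟩ | ⟨a, b, -, h, -⟩)
          · exact WithBot.coe_ne_bot h
          · exact WithBot.coe_ne_bot h.symm
        | coe y => exact withBot_r_coe

/-! ### The main construction -/

section Main

variable {F : Type} [Lattice F]

theorem IsFN.exists_finset (hF : IsFN F) (n : ℕ) :
    ∃ U : Finset F, U.card = n ∧ ∀ x ∈ U, ¬ IsBot x ∧ ¬ IsTop x := by
  have := hF.1
  have hfin : {x : F | IsBot x ∨ IsTop x}.Finite :=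
    Set.Finite.union (Set.Subsingleton.finite fun _ hx _ hy => (hx _).antisymm (hy _))
      (Set.Subsingleton.finite fun _ hx _ hy => (hy _).antisymm (hx _))
  obtain ⟨U, hU, hn⟩ := hfin.infinite_compl.exists_subset_card_eq n
  exact ⟨U, hn, fun x hx => not_or.1 (hU hx)⟩

/-- Doubling `n` points of an FN lattice yields `Bₙ⁺`. -/
theorem IsFN.nonempty_inflate_orderIso (hF : IsFN F) {U : Finset F}
    (hU : ∀ x ∈ U, ¬ IsBot x ∧ ¬ IsTop x) :
    Nonempty (LatCon (Inflate (U : Set F) Prop) ≃o WithTop (Set (Fin U.card))) := by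
  obtain ⟨e⟩ := Inflate.nonempty_latCon_orderIso (U := (U : Set F)) (L := Prop) hF.2.1 hU
  obtain ⟨e'⟩ := LatCon.nonempty_orderIso_prop
  let e₁ : (((U : Set F) : Type) → LatCon Prop) ≃o (Fin U.card → Prop) :=
    { toEquiv := Equiv.arrowCongr U.equivFin e'.toEquiv
      map_rel_iff' := fun {c d} =>
        ⟨fun h x => e'.le_iff_le.1 fun hc => by simpa using h (U.equivFin x) (by simpa using hc),
          fun h i => e'.monotone (h _)⟩ }
  exact ⟨e.trans e₁.withTopCongr⟩

theorem IsFN.exists_of_no_bot (hF : IsFN F) (hbot : ∀ x : F, ¬ IsBot x) (n : ℕ) :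
    ∃ (K : Type) (instK : Lattice K), Infinite K ∧ SDP K instK ∧
      ConIso K instK (WithTop (WithTop (Set (Fin n)))) := by
  have := hF.1
  obtain ⟨U, rfl, hU⟩ := hF.exists_finset n
  obtain ⟨e⟩ := hF.nonempty_inflate_orderIso hU
  have hcon : Nonempty (LatCon (WithBot (Inflate (U : Set F) Prop)) ≃o
      WithTop (LatCon (Inflate (U : Set F) Prop))) := by
    refine LatCon.nonempty_withBot_orderIso fun c x hx => ?_
    obtain ⟨q, hq⟩ := not_forall.1 (hbot x.fst)
    refine LexSum.eq_top_of_r hF.2.1 (Inflate.not_isBot_and_not_isTop hU) c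
      (hx (⟨q, ⊥⟩ ⊓ x) inf_le_right) ?_
    rw [LexSum.fst_inf]
    exact (inf_lt_right.2 hq).ne
  obtain ⟨e'⟩ := hcon
  exact ⟨WithBot (Inflate (U : Set F) Prop), inferInstance,
    .of_injective WithBot.some WithBot.coe_injective,
    (Inflate.sd hF.2.2 (.of_distribLattice Prop)).withBot, ⟨e'.trans e.withTopCongr⟩⟩

theorem IsFN.exists_of_boundedOrder [BoundedOrder F] (hF : IsFN F) (n : ℕ) :
    ∃ (K : Type) (instK : Lattice K), Infinite K ∧ SDP K instK ∧
      ConIso K instK (WithTop (WithTop (Set (Fin n)))) := by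
  have := hF.1
  obtain ⟨U, rfl, hU⟩ := hF.exists_finset n
  obtain ⟨e⟩ := hF.nonempty_inflate_orderIso hU
  obtain ⟨V, hV₁, hV⟩ := hF.exists_finset 1
  obtain ⟨v, rfl⟩ := Finset.card_eq_one.1 hV₁
  obtain ⟨e'⟩ := Inflate.nonempty_latCon_orderIso (U := {v}) (L := Inflate (U : Set F) Prop)
    hF.2.1 (by simpa using hV)
  exact ⟨Inflate {v} (Inflate (U : Set F) Prop), inferInstance, inferInstance,
    Inflate.sd hF.2.2 (Inflate.sd hF.2.2 (.of_distribLattice Prop)),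
    ⟨e'.trans ((OrderIso.funUnique ({v} : Set F) _).trans e).withTopCongr⟩⟩

theorem IsFN.exists_conIso (hF : IsFN F) (n : ℕ) :
    ∃ (K : Type) (instK : Lattice K), Infinite K ∧ SDP K instK ∧
      ConIso K instK (WithTop (WithTop (Set (Fin n)))) := by
  by_cases hbot : ∃ x : F, IsBot x
  · by_cases htop : ∃ x : F, IsTop x
    · obtain ⟨x, hx⟩ := hbot
      obtain ⟨y, hy⟩ := htop
      let _ : BoundedOrder F := { bot := x, bot_le := hx, top := y, le_top := hy }
      exact hF.exists_of_boundedOrder n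
    · exact hF.orderDual.exists_of_no_bot (fun x hx => htop ⟨x.ofDual, hx⟩) n
  · exact hF.exists_of_no_bot (fun x hx => hbot ⟨x, hx⟩) n

end Main

/-! ### STATEMENT 11 -/

/-- For every `n ≥ 0` there is an infinite semidistributive lattice whose
congruence lattice is isomorphic to `Bₙ⁺⁺` (assuming the existence of an FN lattice
containing antichains of every finite size). -/
theorem statement11
    (hFN : ∃ (F : Type) (instF : Lattice F), IsFNP F instF ∧
      (∀ m : ℕ, ∃ S : Finset F,
        S.card = m ∧ IsAntichain (fun x y => lleOf instF x y) (↑S : Set F))) :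
    ∀ n : ℕ, ∃ (K : Type) (instK : Lattice K),
      Infinite K ∧ SDP K instK ∧
      ConIso K instK (WithTop (WithTop (Set (Fin n)))) := by
  obtain ⟨F, instF, hF, -⟩ := hFN
  exact hF.exists_conIso
end

section
/- For every n ≥ 0 there is an infinite semidistributive lattice whose congruence lattice is isomorphic to the ordinal sum Bₙ ∔ B₂, in which every element of Bₙ lies below every element of B₂ (assuming the existence of an FN lattice, i.e., a simple, infinite, semidistributive lattice, containing antichains of every finite size). -/
/-! ### Doubling a set of points -/

/-- The lattice obtained from `F` by replacing each point `u` of `U` with a two-element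
chain. The point `u` has a lower copy (`hi` false) and an upper copy (`hi` true). -/
@[ext]
structure PointDoubling (F : Type*) (U : Set F) where
  pt : F
  hi : Prop
  mem : hi → pt ∈ U

namespace PointDoubling

variable {F : Type*} [Lattice F] {U : Set F}

instance : Lattice (PointDoubling F U) where
  le p q := p.pt ≤ q.pt ∧ (p.pt = q.pt → p.hi → q.hi)
  le_refl p := ⟨le_rfl, fun _ h => h⟩
  le_trans p q r hpq hqr := by
    refine ⟨hpq.1.trans hqr.1, fun h hp => ?_⟩
    have hq : p.pt = q.pt := le_antisymm hpq.1 (h ▸ hqr.1)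
    exact hqr.2 (hq ▸ h) (hpq.2 hq hp)
  le_antisymm p q hpq hqp := by
    have h : p.pt = q.pt := le_antisymm hpq.1 hqp.1
    exact PointDoubling.ext h (propext ⟨hpq.2 h, hqp.2 h.symm⟩)
  sup p q :=
    { pt := p.pt ⊔ q.pt
      hi := (p.pt ⊔ q.pt = p.pt ∧ p.hi) ∨ (p.pt ⊔ q.pt = q.pt ∧ q.hi)
      mem := by
        rintro (⟨h, hp⟩ | ⟨h, hq⟩)
        · rw [h]; exact p.mem hp
        · rw [h]; exact q.mem hq }
  le_sup_left p q := ⟨le_sup_left, fun h hp => Or.inl ⟨h.symm, hp⟩⟩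
  le_sup_right p q := ⟨le_sup_right, fun h hq => Or.inr ⟨h.symm, hq⟩⟩
  sup_le p q r hp hq := by
    refine ⟨sup_le hp.1 hq.1, ?_⟩
    rintro h (⟨h', hi⟩ | ⟨h', hi⟩)
    · exact hp.2 (h'.symm.trans h) hi
    · exact hq.2 (h'.symm.trans h) hi
  inf p q :=
    { pt := p.pt ⊓ q.pt
      hi := p.pt ⊓ q.pt ∈ U ∧ (p.pt ⊓ q.pt = p.pt → p.hi) ∧ (p.pt ⊓ q.pt = q.pt → q.hi)
      mem := fun h => h.1 }
  inf_le_left p q := ⟨inf_le_left, fun h hi => hi.2.1 h⟩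
  inf_le_right p q := ⟨inf_le_right, fun h hi => hi.2.2 h⟩
  le_inf p q r hq hr := by
    refine ⟨le_inf hq.1 hr.1, fun (h : p.pt = q.pt ⊓ r.pt) hi =>
      ⟨h ▸ p.mem hi, fun h' => ?_, fun h' => ?_⟩⟩
    · exact hq.2 (h.trans h') hi
    · exact hr.2 (h.trans h') hi

@[simp] theorem sup_pt (p q : PointDoubling F U) : (p ⊔ q).pt = p.pt ⊔ q.pt := rfl

@[simp] theorem inf_pt (p q : PointDoubling F U) : (p ⊓ q).pt = p.pt ⊓ q.pt := rfl

theorem sup_hi (p q : PointDoubling F U) :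
    (p ⊔ q).hi ↔ (p.pt ⊔ q.pt = p.pt ∧ p.hi) ∨ (p.pt ⊔ q.pt = q.pt ∧ q.hi) := Iff.rfl

theorem inf_hi (p q : PointDoubling F U) :
    (p ⊓ q).hi ↔ p.pt ⊓ q.pt ∈ U ∧ (p.pt ⊓ q.pt = p.pt → p.hi) ∧
      (p.pt ⊓ q.pt = q.pt → q.hi) := Iff.rfl

theorem joinSD (hF : JoinSD F) : JoinSD (PointDoubling F U) := by
  rintro _ x y z rfl h
  have hpt : x.pt ⊔ y.pt = x.pt ⊔ z.pt := congrArg pt h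
  have hsd := hF _ _ _ _ rfl hpt
  have hhi := iff_of_eq (congrArg hi h)
  rw [sup_hi, sup_hi] at hhi
  refine PointDoubling.ext hsd (propext ?_)
  rw [sup_hi, sup_hi, inf_hi, inf_pt, ← hsd]
  have hy : x.pt ⊔ y.pt = y.pt ⊓ z.pt → y.pt = x.pt ⊔ y.pt ∧ z.pt = x.pt ⊔ y.pt := fun e =>
    ⟨le_antisymm le_sup_right (e.le.trans inf_le_left),
      le_antisymm (hpt ▸ le_sup_right) (e.le.trans inf_le_right)⟩
  rw [← hpt] at hhi
  constructor
  · intro hl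
    by_cases hx : x.pt ⊔ y.pt = x.pt ∧ x.hi
    · exact Or.inl hx
    · obtain ⟨e₁, h₁⟩ := hl.resolve_left hx
      obtain ⟨e₂, h₂⟩ := (hhi.1 hl).resolve_left hx
      have e : y.pt ⊓ z.pt = y.pt := inf_eq_left.2 (e₁.symm.trans e₂).le
      exact Or.inr ⟨e₁.trans e.symm, by rw [e]; exact y.mem h₁, fun _ => h₁, fun _ => h₂⟩
  · rintro (hx | ⟨e, -, h₁, -⟩)
    · exact Or.inl hx
    · exact Or.inr ⟨(hy e).1.symm, h₁ (e.symm.trans (hy e).1.symm)⟩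

theorem meetSD (hF : MeetSD F) : MeetSD (PointDoubling F U) := by
  rintro _ x y z rfl h
  have hpt : x.pt ⊓ y.pt = x.pt ⊓ z.pt := congrArg pt h
  have hsd := hF _ _ _ _ rfl hpt
  have hhi := iff_of_eq (congrArg hi h)
  rw [inf_hi, inf_hi] at hhi
  refine PointDoubling.ext hsd (propext ?_)
  rw [inf_hi, inf_hi, sup_hi, sup_pt, ← hsd]
  have hy : x.pt ⊓ y.pt = y.pt ⊔ z.pt → y.pt = x.pt ⊓ y.pt ∧ z.pt = x.pt ⊓ y.pt := fun e =>
    ⟨le_antisymm (le_sup_left.trans e.ge) inf_le_right,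
      le_antisymm (le_sup_right.trans e.ge) (hpt ▸ inf_le_right)⟩
  rw [← hpt] at hhi
  constructor
  · rintro ⟨hU, h₁, h₂⟩
    refine ⟨hU, h₁, fun e => Or.inl ⟨e.symm.trans (hy e).1.symm, h₂ (hy e).1.symm⟩⟩
  · rintro ⟨hU, h₁, h₂⟩
    by_contra hn
    have hny : ¬ (x.pt ⊓ y.pt = y.pt → y.hi) := fun h => hn ⟨hU, h₁, h⟩
    have hnz : ¬ (x.pt ⊓ y.pt = z.pt → z.hi) := fun h => hn (hhi.2 ⟨hU, h₁, h⟩)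
    push Not at hny hnz
    have e : x.pt ⊓ y.pt = y.pt ⊔ z.pt := 
      (sup_idem _).symm.trans (congrArg₂ (· ⊔ ·) hny.1 hnz.1)
    rcases h₂ e with h | h
    · exact hny.2 h.2
    · exact hnz.2 h.2

theorem sd (hF : SD F) : SD (PointDoubling F U) := ⟨joinSD hF.1, meetSD hF.2⟩

/-- The lower copy of a point. -/
def lower (U : Set F) (x : F) : PointDoubling F U := ⟨x, False, False.elim⟩

/-- The upper copy of a doubled point. -/
def upper {u : F} (hu : u ∈ U) : PointDoubling F U := ⟨u, True, fun _ => hu⟩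

/-- The congruence identifying the two copies of each point of `S`. -/
def collapse (S : Set F) : LatCon (PointDoubling F U) where
  r p q := p.pt = q.pt ∧ (p.pt ∉ S → (p.hi ↔ q.hi))
  refl' p := ⟨rfl, fun _ => Iff.rfl⟩
  symm' h := ⟨h.1.symm, fun hS => (h.2 (h.1 ▸ hS)).symm⟩
  trans' h h' := ⟨h.1.trans h'.1, fun hS => (h.2 hS).trans (h'.2 (h.1 ▸ hS))⟩
  sup' := by
    rintro p q p' q' ⟨h, hi⟩ ⟨h', hi'⟩
    refine ⟨by simp [h, h'], fun hS => ?_⟩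
    rw [sup_pt] at hS
    rw [sup_hi, sup_hi, ← h, ← h']
    refine or_congr (and_congr_right fun e => hi (e ▸ hS)) (and_congr_right fun e => hi' (e ▸ hS))
  inf' := by
    rintro p q p' q' ⟨h, hi⟩ ⟨h', hi'⟩
    refine ⟨by simp [h, h'], fun hS => ?_⟩
    rw [inf_pt] at hS
    rw [inf_hi, inf_hi, ← h, ← h']
    exact and_congr_right fun _ => and_congr (forall_congr' fun e => hi (e ▸ hS))
      (forall_congr' fun e => hi' (e ▸ hS))

theorem collapse_le_collapse {S T : Set F} (hS : S ⊆ U) :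
    (collapse S : LatCon (PointDoubling F U)) ≤ collapse T ↔ S ⊆ T := by
  constructor
  · intro h u hu
    by_contra hT
    have := h (lower U u) (upper (hS hu)) ⟨rfl, fun hn => (hn hu).elim⟩
    exact (this.2 hT).2 trivial
  · exact fun h p q hpq => ⟨hpq.1, fun hT => hpq.2 fun hS => hT (h hS)⟩

theorem not_forall_collapse [Nontrivial F] (S : Set F) :
    ¬ ∀ p q : PointDoubling F U, (collapse S).r p q := fun h => by
  obtain ⟨x, y, hxy⟩ := exists_pair_ne F
  exact hxy (h (lower U x) (lower U y)).1

theorem exists_eq_collapse {θ : LatCon (PointDoubling F U)}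
    (hθ : ∀ p q, θ.r p q → p.pt = q.pt) :
    ∃ S ⊆ U, θ = collapse S := by
  refine ⟨{u | ∃ hu : u ∈ U, θ.r (lower U u) (upper hu)}, fun u hu => hu.1, ?_⟩
  ext p q
  constructor
  · refine fun h => ⟨hθ p q h, fun hS => ?_⟩
    obtain ⟨x, i, hi⟩ := p
    obtain ⟨y, j, hj⟩ := q
    obtain rfl : x = y := hθ _ _ h
    by_contra hn
    refine hS ?_
    by_cases hi' : i
    · have hj' : ¬ j := fun hj' => hn ⟨fun _ => hj', fun _ => hi'⟩
      refine ⟨hi hi', θ.symm' ?_⟩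
      simpa [lower, upper, hi', hj'] using h
    · have hj' : j := by_contra fun hj' =>
        hn ⟨fun h => (hi' h).elim, fun h => (hj' h).elim⟩
      refine ⟨hj hj', ?_⟩
      simpa [lower, upper, hi', hj'] using h
  · rintro ⟨e, h⟩
    obtain ⟨x, i, hi⟩ := p
    obtain ⟨y, j, hj⟩ := q
    obtain rfl : x = y := e
    by_cases hij : i ↔ j
    · obtain rfl : i = j := propext hij
      exact θ.refl' _
    · obtain ⟨hu, hr⟩ := not_not.1 fun hS => hij (h hS)
      by_cases hi' : i
      · have hj' : ¬ j := fun hj' => hij ⟨fun _ => hj', fun _ => hi'⟩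
        have := θ.symm' hr
        simpa [lower, upper, hi', hj'] using this
      · have hj' : j := by_contra fun hj' =>
          hij ⟨fun h => (hi' h).elim, fun h => (hj' h).elim⟩
        simpa [lower, upper, hi', hj'] using hr

/-- The image in `F` of a congruence of the doubling. -/
def push (θ : LatCon (PointDoubling F U)) : LatCon F where
  r := Relation.EqvGen fun x y => ∃ p q, θ.r p q ∧ p.pt = x ∧ q.pt = y
  refl' := Relation.EqvGen.refl
  symm' := Relation.EqvGen.symm _ _
  trans' := Relation.EqvGen.trans _ _ _
  sup' := by
    have key : ∀ {x y : F} (z : F),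
        Relation.EqvGen (fun x y => ∃ p q, θ.r p q ∧ p.pt = x ∧ q.pt = y) x y →
        Relation.EqvGen (fun x y => ∃ p q, θ.r p q ∧ p.pt = x ∧ q.pt = y) (x ⊔ z) (y ⊔ z) := by
      intro x y z h
      induction h with
      | rel x y h =>
        obtain ⟨p, q, h, rfl, rfl⟩ := h
        exact .rel _ _ ⟨_, _, θ.sup' h (θ.refl' (lower U z)), rfl, rfl⟩
      | refl x => exact .refl _
      | symm x y _ ih => exact .symm _ _ ih
      | trans x y w _ _ ih ih' => exact .trans _ _ _ ih ih'
    intro x y x' y' h h'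
    refine .trans _ _ _ (key x' h) ?_
    rw [sup_comm y, sup_comm y]
    exact key y h'
  inf' := by
    have key : ∀ {x y : F} (z : F),
        Relation.EqvGen (fun x y => ∃ p q, θ.r p q ∧ p.pt = x ∧ q.pt = y) x y →
        Relation.EqvGen (fun x y => ∃ p q, θ.r p q ∧ p.pt = x ∧ q.pt = y) (x ⊓ z) (y ⊓ z) := by
      intro x y z h
      induction h with
      | rel x y h =>
        obtain ⟨p, q, h, rfl, rfl⟩ := h
        exact .rel _ _ ⟨_, _, θ.inf' h (θ.refl' (lower U z)), rfl, rfl⟩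
      | refl x => exact .refl _
      | symm x y _ ih => exact .symm _ _ ih
      | trans x y w _ _ ih ih' => exact .trans _ _ _ ih ih'
    intro x y x' y' h h'
    refine .trans _ _ _ (key x' h) ?_
    rw [inf_comm y, inf_comm y]
    exact key y h'

theorem le_lower_of_rel {θ : LatCon (PointDoubling F U)} {u : F} {hu : u ∈ U}
    (hθ : ¬ θ.r (lower U u) (upper hu)) {p q : PointDoubling F U} (h : θ.r p q)
    (hp : p ≤ lower U u) : q ≤ lower U u := by
  by_contra hq
  have h₁ := θ.inf' (θ.sup' h (θ.refl' (lower U u))) (θ.refl' (upper hu))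
  have hlt : lower U u ≤ upper hu := ⟨le_rfl, fun _ _ => trivial⟩
  have hle : upper hu ≤ q ⊔ lower U u := by
    refine ⟨le_sup_right, fun e _ => ?_⟩
    rw [sup_hi]
    have hqu : q.pt ≤ u := sup_eq_right.1 (show q.pt ⊔ u = u from e.symm)
    have : u = q.pt ∧ q.hi := by
      by_contra hn
      exact hq ⟨hqu, fun e h => hn ⟨e.symm, h⟩⟩
    exact Or.inl ⟨e.symm.trans this.1, this.2⟩
  rw [sup_eq_right.2 hp, inf_eq_left.2 hlt, inf_eq_right.2 hle] at h₁
  exact hθ h₁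

theorem upper_le_of_rel {θ : LatCon (PointDoubling F U)} {u : F} {hu : u ∈ U}
    (hθ : ¬ θ.r (lower U u) (upper hu)) {p q : PointDoubling F U} (h : θ.r p q)
    (hp : upper hu ≤ p) : upper hu ≤ q := by
  by_contra hq
  have h₁ := θ.symm' (θ.sup' (θ.inf' h (θ.refl' (upper hu))) (θ.refl' (lower U u)))
  have hlt : lower U u ≤ upper hu := ⟨le_rfl, fun _ _ => trivial⟩
  have hle : q ⊓ upper hu ≤ lower U u := by
    refine ⟨inf_le_right, fun e hi => ?_⟩
    rw [inf_hi] at hi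
    have huq : u ≤ q.pt := inf_eq_right.1 (show q.pt ⊓ u = u from e)
    exact hq ⟨huq, fun e' _ => hi.2.1 (e.trans e')⟩
  rw [sup_eq_right.2 hle, inf_eq_right.2 hp, sup_eq_left.2 hlt] at h₁
  exact hθ h₁

/-- A congruence separating the copies of `u` cannot link `u` to a point incomparable with `u`. -/
theorem incomparable_of_push {θ : LatCon (PointDoubling F U)} {u : F} {hu : u ∈ U}
    (hθ : ¬ θ.r (lower U u) (upper hu)) {x y : F} (h : (push θ).r x y) :
    (¬ x ≤ u ∧ ¬ u ≤ x) ↔ (¬ y ≤ u ∧ ¬ u ≤ y) := by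
  have key : ∀ p q : PointDoubling F U, θ.r p q → (¬ p.pt ≤ u ∧ ¬ u ≤ p.pt) →
      (¬ q.pt ≤ u ∧ ¬ u ≤ q.pt) := by
    intro p q h hp
    have h₁ : ¬ q ≤ lower U u := fun hq => hp.1 (le_lower_of_rel hθ (θ.symm' h) hq).1
    have h₂ : ¬ upper hu ≤ q := fun hq => hp.2 (upper_le_of_rel hθ (θ.symm' h) hq).1
    have hne : q.pt ≠ u := by
      intro e
      by_cases hi : q.hi
      · exact h₂ ⟨e.ge, fun _ _ => hi⟩
      · exact h₁ ⟨e.le, fun _ h => hi h⟩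
    exact ⟨fun hq => h₁ ⟨hq, fun e => (hne e).elim⟩, fun hq => h₂ ⟨hq, fun e => (hne e.symm).elim⟩⟩
  induction h with
  | rel x y h =>
    obtain ⟨p, q, h, rfl, rfl⟩ := h
    exact ⟨key p q h, key q p (θ.symm' h)⟩
  | refl x => exact Iff.rfl
  | symm x y _ ih => exact ih.symm
  | trans x y z _ _ ih ih' => exact ih.trans ih'

theorem eq_collapse_or_eq_top (hF : IsSimpleLat F)
    (hU : ∀ u ∈ U, ∃ w : F, ¬ w ≤ u ∧ ¬ u ≤ w) (θ : LatCon (PointDoubling F U)) :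
    (∃ S ⊆ U, θ = collapse S) ∨ θ = ⊤ := by
  rcases hF.2 (push θ) with h | h
  · refine Or.inl (exists_eq_collapse fun p q hpq => ?_)
    have : (push θ).r p.pt q.pt := .rel _ _ ⟨p, q, hpq, rfl, rfl⟩
    rw [h] at this
    exact this
  · right
    have all : ∀ x y, (push θ).r x y := fun x y => by rw [h]; trivial
    have hsplit : ∀ u (hu : u ∈ U), θ.r (lower U u) (upper hu) := by
      intro u hu
      by_contra hθ
      obtain ⟨w, hw⟩ := hU u hu
      exact ((incomparable_of_push hθ (all w u)).1 hw).1 le_rfl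
    have hlow : ∀ p : PointDoubling F U, θ.r (lower U p.pt) p := by
      rintro ⟨x, i, hi⟩
      by_cases h : i
      · simpa [lower, upper, h] using hsplit x (hi h)
      · simpa [lower, h] using θ.refl' (lower U x)
    have hgen : ∀ x y, (push θ).r x y → θ.r (lower U x) (lower U y) := by
      intro x y h
      induction h with
      | rel x y h =>
        obtain ⟨p, q, h, rfl, rfl⟩ := h
        exact θ.trans' (hlow p) (θ.trans' h (θ.symm' (hlow q)))
      | refl x => exact θ.refl' _
      | symm x y _ ih => exact θ.symm' ih
      | trans x y z _ _ ih ih' => exact θ.trans' ih ih'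
    refine le_antisymm le_top fun p q _ => ?_
    exact θ.trans' (θ.symm' (hlow p)) (θ.trans' (hgen _ _ (all _ _)) (hlow q))

end PointDoubling

/-! ### The pentagon with its isolated interval replaced by a lattice -/

/-- The pentagon `N₅` in which the two-element side is replaced by the lattice `G`. -/
inductive Pentagon (G : Type*)
  | bot
  | side
  | mid (x : G)
  | top

namespace Pentagon

variable {G : Type*} [Lattice G]

/-- The order of the pentagon. -/
protected def le : Pentagon G → Pentagon G → Prop
  | bot, _ => True
  | side, bot => False
  | side, side => True
  | side, mid _ => False
  | side, top => True
  | mid _, bot => False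
  | mid _, side => False
  | mid x, mid y => x ≤ y
  | mid _, top => True
  | top, bot => False
  | top, side => False
  | top, mid _ => False
  | top, top => True

/-- The join of the pentagon. -/
protected def sup : Pentagon G → Pentagon G → Pentagon G
  | bot, q => q
  | side, bot => side
  | side, side => side
  | side, mid _ => top
  | side, top => top
  | mid x, bot => mid x
  | mid _, side => top
  | mid x, mid y => mid (x ⊔ y)
  | mid _, top => top
  | top, _ => top

/-- The meet of the pentagon. -/
protected def inf : Pentagon G → Pentagon G → Pentagon G
  | bot, _ => bot
  | side, bot => bot
  | side, side => side
  | side, mid _ => bot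
  | side, top => side
  | mid _, bot => bot
  | mid _, side => bot
  | mid x, mid y => mid (x ⊓ y)
  | mid x, top => mid x
  | top, q => q

instance : Lattice (Pentagon G) where
  le := Pentagon.le
  le_refl p := by cases p <;> simp [Pentagon.le]
  le_trans p q r := by
    cases p <;> cases q <;> cases r <;> simp [Pentagon.le]
    exact le_trans
  le_antisymm p q := by
    cases p <;> cases q <;> simp [Pentagon.le]
    exact le_antisymm
  sup := Pentagon.sup
  le_sup_left p q := by cases p <;> cases q <;> simp [Pentagon.le, Pentagon.sup]
  le_sup_right p q := by cases p <;> cases q <;> simp [Pentagon.le, Pentagon.sup]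
  sup_le p q r := by
    cases p <;> cases q <;> cases r <;> simp +contextual [Pentagon.le, Pentagon.sup]
  inf := Pentagon.inf
  inf_le_left p q := by cases p <;> cases q <;> simp [Pentagon.le, Pentagon.inf]
  inf_le_right p q := by cases p <;> cases q <;> simp [Pentagon.le, Pentagon.inf]
  le_inf p q r := by
    cases p <;> cases q <;> cases r <;> simp +contextual [Pentagon.le, Pentagon.inf]

theorem sup_def (p q : Pentagon G) : p ⊔ q = Pentagon.sup p q := rfl

theorem inf_def (p q : Pentagon G) : p ⊓ q = Pentagon.inf p q := rfl

theorem sd (hG : SD G) : SD (Pentagon G) := by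
  constructor
  · rintro _ x y z rfl
    cases x <;> cases y <;> cases z <;> simp [sup_def, inf_def, Pentagon.sup, Pentagon.inf]
    · rintro rfl; simp
    · exact hG.1 _ _ _ _ rfl
  · rintro _ x y z rfl
    cases x <;> cases y <;> cases z <;> simp [sup_def, inf_def, Pentagon.sup, Pentagon.inf]
    · exact hG.2 _ _ _ _ rfl
    · rintro rfl; simp

/-- The relation underlying `lift`. -/
inductive LiftRel (θ : LatCon G) : Pentagon G → Pentagon G → Prop
  | refl (p) : LiftRel θ p p
  | mid {x y} (h : θ.r x y) : LiftRel θ (mid x) (mid y)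

/-- The congruence of the pentagon extending a congruence of `G` by singletons. -/
def lift (θ : LatCon G) : LatCon (Pentagon G) where
  r := LiftRel θ
  refl' := .refl
  symm' := by
    rintro p q (_ | h)
    · exact .refl _
    · exact .mid (θ.symm' h)
  trans' := by
    rintro p q r (_ | h) h'
    · exact h'
    · rcases h' with _ | h'
      · exact .mid h
      · exact .mid (θ.trans' h h')
  sup' := by
    rintro p q p' q' (_ | h) (_ | h')
    · exact .refl _
    · cases p with
      | mid x => exact .mid (θ.sup' (θ.refl' x) h')
      | bot => exact .mid h'
      | side => exact .refl _
      | top => exact .refl _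
    · cases p' with
      | mid x => exact .mid (θ.sup' h (θ.refl' x))
      | bot => exact .mid h
      | side => exact .refl _
      | top => exact .refl _
    · exact .mid (θ.sup' h h')
  inf' := by
    rintro p q p' q' (_ | h) (_ | h')
    · exact .refl _
    · cases p with
      | mid x => exact .mid (θ.inf' (θ.refl' x) h')
      | bot => exact .refl _
      | side => exact .refl _
      | top => exact .mid h'
    · cases p' with
      | mid x => exact .mid (θ.inf' h (θ.refl' x))
      | bot => exact .refl _
      | side => exact .refl _
      | top => exact .mid h
    · exact .mid (θ.inf' h h')

theorem lift_mid_mid {θ : LatCon G} {x y : G} : (lift θ).r (mid x) (mid y) ↔ θ.r x y := by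
  constructor
  · rintro (_ | h)
    · exact θ.refl' x
    · exact h
  · exact .mid

theorem lift_le_lift {θ φ : LatCon G} : lift θ ≤ lift φ ↔ θ ≤ φ := by
  constructor
  · exact fun h x y hxy => lift_mid_mid.1 (h (mid x) (mid y) (.mid hxy))
  · rintro h p q (_ | hxy)
    · exact .refl _
    · exact .mid (h _ _ hxy)

/-- The coordinates of the canonical map from the pentagon onto the square `B₂`. -/
def coord : Fin 2 → Pentagon G → Prop
  | _, bot => False
  | i, side => i = 1
  | i, mid _ => i = 0
  | _, top => True

theorem coord_sup (i : Fin 2) (p q : Pentagon G) :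
    coord i (p ⊔ q) ↔ coord i p ∨ coord i q := by
  fin_cases i <;> cases p <;> cases q <;> simp [coord, sup_def, Pentagon.sup]

theorem coord_inf (i : Fin 2) (p q : Pentagon G) :
    coord i (p ⊓ q) ↔ coord i p ∧ coord i q := by
  fin_cases i <;> cases p <;> cases q <;> simp [coord, inf_def, Pentagon.inf]

/-- The congruence of the pentagon that forgets the coordinates in `T`. -/
def forget (T : Set (Fin 2)) : LatCon (Pentagon G) where
  r p q := ∀ i ∉ T, coord i p ↔ coord i q
  refl' _ _ _ := Iff.rfl
  symm' h i hi := (h i hi).symm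
  trans' h h' i hi := (h i hi).trans (h' i hi)
  sup' h h' i hi := by rw [coord_sup, coord_sup, h i hi, h' i hi]
  inf' h h' i hi := by rw [coord_inf, coord_inf, h i hi, h' i hi]

theorem forget_le_forget [Nonempty G] {S T : Set (Fin 2)} :
    (forget S : LatCon (Pentagon G)) ≤ forget T ↔ S ⊆ T := by
  obtain ⟨g⟩ := ‹Nonempty G›
  constructor
  · intro h i hi
    by_contra hT
    have hne : ∀ j ∉ S, j ≠ i := fun j hj e => hj (e ▸ hi)
    fin_cases i
    · exact absurd (h bot (mid g) (fun j hj => by simpa [coord] using hne j hj) _ hT)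
        (by simp [coord])
    · exact absurd (h bot side (fun j hj => by simpa [coord] using hne j hj) _ hT)
        (by simp [coord])
  · exact fun h p q hpq i hi => hpq i fun hS => hi (h hS)

theorem lift_le_forget (θ : LatCon G) (T : Set (Fin 2)) : lift θ ≤ forget T := by
  rintro p q (_ | h)
  · exact (forget T).refl' p
  · exact fun _ _ => Iff.rfl

theorem lift_top : lift (⊤ : LatCon G) = forget ∅ := by
  refine le_antisymm (lift_le_forget _ _) fun p q h => ?_
  have h₀ := h 0 (Set.notMem_empty _)
  have h₁ := h 1 (Set.notMem_empty _)
  cases p <;> cases q <;> first | exact .refl _ | exact .mid trivial | simp [coord] at h₀ h₁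

theorem forall_rel_of_forget_le_lift {θ : LatCon G} {T : Set (Fin 2)}
    (h : forget T ≤ lift θ) (x y : G) : θ.r x y :=
  lift_mid_mid.1 (h (mid x) (mid y) fun _ _ => Iff.rfl)

/-- The congruence of `G` induced by a congruence of the pentagon. -/
def restrict (c : LatCon (Pentagon G)) : LatCon G where
  r x y := c.r (mid x) (mid y)
  refl' _ := c.refl' _
  symm' h := c.symm' h
  trans' h h' := c.trans' h h'
  sup' h h' := c.sup' h h'
  inf' h h' := c.inf' h h'

theorem eq_lift_or_eq_forget (c : LatCon (Pentagon G)) :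
    (∃ θ, c = lift θ) ∨ ∃ T, c = forget T := by
  have bs_of_mt : ∀ x, c.r (mid x) top → c.r bot side := fun x h => c.inf' h (c.refl' side)
  have mt_of_bs : ∀ x, c.r bot side → c.r (mid x) top := fun x h => c.sup' h (c.refl' (mid x))
  have st_of_bm : ∀ x, c.r bot (mid x) → c.r side top := fun x h => c.sup' h (c.refl' side)
  have bm_of_st : ∀ x, c.r side top → c.r bot (mid x) := fun x h => c.inf' h (c.refl' (mid x))
  have bs_of_bt : c.r bot top → c.r bot side := fun h => c.inf' h (c.refl' side)
  have st_of_bt : c.r bot top → c.r side top := fun h => c.sup' h (c.refl' side)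
  have bs_of_sm : ∀ x, c.r side (mid x) → c.r bot side := fun x h =>
    c.symm' (c.inf' h (c.refl' side))
  have st_of_sm : ∀ x, c.r side (mid x) → c.r side top := fun x h => c.sup' (c.refl' side) h
  have hs : ∀ p q, c.r p q → c.r q p := fun _ _ => c.symm'
  have ht : ∀ p q r, c.r p q → c.r q r → c.r p r := fun _ _ _ => c.trans'
  by_cases hbs : c.r bot side <;> by_cases hst : c.r side top
  · right
    have hb : ∀ p, c.r bot p := by
      rintro (_ | _ | x | _)
      · exact c.refl' _
      · exact hbs
      · exact bm_of_st x hst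
      · exact c.trans' hbs hst
    refine ⟨Set.univ, ?_⟩
    ext p q
    exact iff_of_true (c.trans' (c.symm' (hb p)) (hb q)) fun i hi => (hi trivial).elim
  · right
    refine ⟨{1}, ?_⟩
    ext p q
    have h₀ : (forget {1}).r p q ↔ (coord 0 p ↔ coord 0 q) := by simp [forget]
    rw [h₀]
    cases p <;> cases q <;> simp only [coord, c.refl'] <;> grind
  · right
    refine ⟨{0}, ?_⟩
    ext p q
    have h₁ : (forget {0}).r p q ↔ (coord 1 p ↔ coord 1 q) := by simp [forget]
    rw [h₁]
    cases p <;> cases q <;> simp only [coord, c.refl'] <;> grind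
  · left
    refine ⟨restrict c, ?_⟩
    ext p q
    constructor
    · intro h
      cases p <;> cases q <;> first | exact .refl _ | exact .mid h | grind
    · rintro (_ | h)
      · exact c.refl' _
      · exact h

end Pentagon

/-! ### STATEMENT 12 -/

/-- For every `n ≥ 0` there is an infinite semidistributive lattice whose
congruence lattice is isomorphic to the ordinal sum `Bₙ ∔ B₂` (every element of
`Bₙ` below every element of `B₂`), assuming the existence of an FN lattice
containing antichains of every finite size.  The ordinal sum is realized as the
lexicographic sum `Set (Fin n) ⊕ₗ Set (Fin 2)`. -/
theorem statement12
    (hFN : ∃ (F : Type) (instF : Lattice F), IsFNP F instF ∧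
      (∀ m : ℕ, ∃ S : Finset F,
        S.card = m ∧ IsAntichain (fun x y => lleOf instF x y) (↑S : Set F))) :
    ∀ n : ℕ, ∃ (K : Type) (instK : Lattice K),
      Infinite K ∧ SDP K instK ∧
      ConIso K instK (Set (Fin n) ⊕ₗ Set (Fin 2)) := by
  intro n
  obtain ⟨F, instF, ⟨hinf, hsimple, hsd⟩, hanti⟩ := hFN
  obtain ⟨A, hA, hAanti⟩ := hanti (n + 2)
  obtain ⟨B, hBA, hB⟩ := Finset.exists_subset_card_eq (show n ≤ A.card by omega)
  let e : Fin n ≃ B := (Fintype.equivFinOfCardEq (by simpa using hB)).symm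
  let f : Fin n → F := fun i => e i
  have hf : Function.Injective f := Subtype.val_injective.comp e.injective
  have hfU : Set.range f = (B : Set F) := by
    ext x
    exact ⟨fun ⟨i, hi⟩ => hi ▸ (e i).2, fun hx => ⟨e.symm ⟨x, hx⟩, by simp [f]⟩⟩
  let U : Set F := Set.range f
  have hU : ∀ u ∈ U, ∃ w : F, ¬ w ≤ u ∧ ¬ u ≤ w := by
    intro u hu
    have huA : u ∈ A := hBA (by simpa [U, hfU] using hu)
    obtain ⟨w, hw, hne⟩ := Finset.exists_mem_ne (show 1 < A.card by omega) u
    exact ⟨w, hAanti hw huA hne, hAanti huA hw hne.symm⟩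
  have : Nontrivial F := ⟨hsimple.1⟩
  have : Infinite (PointDoubling F U) :=
    Infinite.of_injective (PointDoubling.lower U) fun _ _ h => congrArg PointDoubling.pt h
  let Φ : Set (Fin n) ⊕ₗ Set (Fin 2) → LatCon (Pentagon (PointDoubling F U)) := fun d =>
    Sum.elim (fun S => Pentagon.lift (PointDoubling.collapse (f '' S)))
      Pentagon.forget (ofLex d)
  have hΦ : ∀ d d', Φ d ≤ Φ d' ↔ d ≤ d' := by
    rintro (S | T) (S' | T')
    · refine Pentagon.lift_le_lift.trans ((PointDoubling.collapse_le_collapse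
        (Set.image_subset_range f S)).trans ?_)
      exact (Set.image_subset_image_iff hf).trans Sum.Lex.inl_le_inl_iff.symm
    · exact iff_of_true (Pentagon.lift_le_forget _ _) (Sum.Lex.inl_le_inr _ _)
    · exact iff_of_false
        (fun h => PointDoubling.not_forall_collapse _ (Pentagon.forall_rel_of_forget_le_lift h))
        Sum.Lex.not_inr_le_inl
    · exact Pentagon.forget_le_forget.trans Sum.Lex.inr_le_inr_iff.symm
  have hsurj : Function.Surjective Φ := by
    intro c
    rcases Pentagon.eq_lift_or_eq_forget c with ⟨θ, rfl⟩ | ⟨T, rfl⟩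
    · rcases PointDoubling.eq_collapse_or_eq_top hsimple hU θ with ⟨S, hS, rfl⟩ | rfl
      · refine ⟨toLex (Sum.inl (f ⁻¹' S)), ?_⟩
        change Pentagon.lift (PointDoubling.collapse (f '' (f ⁻¹' S))) = _
        rw [Set.image_preimage_eq_of_subset hS]
      · exact ⟨toLex (Sum.inr ∅), Pentagon.lift_top.symm⟩
    · exact ⟨toLex (Sum.inr T), rfl⟩
  exact ⟨Pentagon (PointDoubling F U), inferInstance,
    Infinite.of_injective Pentagon.mid fun _ _ h => by injection h,
    Pentagon.sd (PointDoubling.sd hsd),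
    ⟨(RelIso.ofSurjective (OrderEmbedding.ofMapLEIff Φ hΦ) hsurj).symm⟩⟩
end

section
/- Let L be a finite semidistributive lattice with more than two elements having an isolated interval [a, b], let L^{a,b} = L ∖ {a, b}, let F be an FN lattice, and let K = L^{a,b} ⊔ F be ordered by: on L^{a,b}, the order of L; on F, the order of F; for x ∈ L^{a,b} and y ∈ F, x < y iff x ≤ a in L, and y < x iff b ≤ x in L. Then the ordered set K is a lattice and L^{a,b} is a sublattice of K. -/
/-! ### The gluing is a lattice -/

section Isolated

variable {L : Type*} [Lattice L] {a b : L}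

theorem Isolated.sup_ne (h : Isolated a b) {x y : L} (hx : x ≠ a ∧ x ≠ b) (hy : y ≠ a ∧ y ≠ b) :
    x ⊔ y ≠ a ∧ x ⊔ y ≠ b :=
  ⟨fun e => (h.2.1.2 e).elim hx.1 hy.1, fun e => (h.2.2.2.1.2 e).elim hx.2 hy.2⟩

theorem Isolated.inf_ne (h : Isolated a b) {x y : L} (hx : x ≠ a ∧ x ≠ b) (hy : y ≠ a ∧ y ≠ b) :
    x ⊓ y ≠ a ∧ x ⊓ y ≠ b :=
  ⟨fun e => (h.2.2.1.2 e).elim hx.1 hy.1, fun e => (h.2.2.2.2.2 e).elim hx.2 hy.2⟩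

theorem Isolated.le_left_of_le_right (h : Isolated a b) {x : L} (hx : x ≠ b) (hxb : x ≤ b) :
    x ≤ a := by
  rcases h.1.eq_or_eq le_sup_right (sup_le hxb h.1.le) with e | e
  · exact e ▸ le_sup_left
  · exact ((h.2.2.2.1.2 e).elim hx h.1.ne).elim

theorem Isolated.right_le_of_left_le (h : Isolated a b) {x : L} (hx : x ≠ a) (hax : a ≤ x) :
    b ≤ x := by
  rcases h.1.eq_or_eq (le_inf hax h.1.le) inf_le_right with e | e
  · exact ((h.2.2.1.2 e).elim hx h.1.ne').elim
  · exact e ▸ inf_le_left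

end Isolated

section Glued

variable {L F : Type*} [Lattice L] [Lattice F] {a b : L}

theorem gle_refl (x : Glued L F a b) : gle a b x x := by
  rcases x with x | x <;> exact le_refl _

theorem gle_trans (hab : a < b) {x y z : Glued L F a b} (hxy : gle a b x y) (hyz : gle a b y z) :
    gle a b x z := by
  rcases x with x | x <;> rcases y with y | y <;> rcases z with z | z <;>
    simp only [gle] at hxy hyz ⊢
  · exact hxy.trans hyz
  · exact hxy.trans hyz
  · exact hxy.trans (hab.le.trans hyz)
  · exact hxy
  · exact hxy.trans hyz
  · exact (hab.not_ge (hxy.trans hyz)).elim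
  · exact hyz
  · exact hxy.trans hyz

theorem gle_antisymm (hab : a < b) {x y : Glued L F a b} (hxy : gle a b x y) (hyx : gle a b y x) :
    x = y := by
  rcases x with x | x <;> rcases y with y | y <;> simp only [gle] at hxy hyx
  · exact congrArg Sum.inl (Subtype.ext (le_antisymm hxy hyx))
  · exact (hab.not_ge (hyx.trans hxy)).elim
  · exact (hab.not_ge (hxy.trans hyx)).elim
  · exact congrArg Sum.inr (le_antisymm hxy hyx)

/-- `z` is a least upper bound of `x` and `y` for the order `gle a b`. -/
def IsGluedSup (x y z : Glued L F a b) : Prop :=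
  gle a b x z ∧ gle a b y z ∧ ∀ w, gle a b x w → gle a b y w → gle a b z w

/-- `z` is a greatest lower bound of `x` and `y` for the order `gle a b`. -/
def IsGluedInf (x y z : Glued L F a b) : Prop :=
  gle a b z x ∧ gle a b z y ∧ ∀ w, gle a b w x → gle a b w y → gle a b w z

theorem IsGluedSup.symm {x y z : Glued L F a b} (h : IsGluedSup x y z) : IsGluedSup y x z :=
  ⟨h.2.1, h.1, fun w hy hx => h.2.2 w hx hy⟩

theorem IsGluedInf.symm {x y z : Glued L F a b} (h : IsGluedInf x y z) : IsGluedInf y x z :=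
  ⟨h.2.1, h.1, fun w hy hx => h.2.2 w hx hy⟩

theorem isGluedSup_inl (x y : {z : L // z ≠ a ∧ z ≠ b})
    (h : (x : L) ⊔ y ≠ a ∧ (x : L) ⊔ y ≠ b) :
    IsGluedSup (F := F) (Sum.inl x) (Sum.inl y) (Sum.inl ⟨(x : L) ⊔ y, h⟩) := by
  refine ⟨le_sup_left (a := (x : L)), le_sup_right (a := (x : L)), ?_⟩
  rintro (w | w) hx hy <;> exact sup_le (α := L) hx hy

theorem isGluedInf_inl (x y : {z : L // z ≠ a ∧ z ≠ b})
    (h : (x : L) ⊓ y ≠ a ∧ (x : L) ⊓ y ≠ b) :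
    IsGluedInf (F := F) (Sum.inl x) (Sum.inl y) (Sum.inl ⟨(x : L) ⊓ y, h⟩) := by
  refine ⟨inf_le_left (a := (x : L)), inf_le_right (a := (x : L)), ?_⟩
  rintro (w | w) hx hy <;> exact le_inf (α := L) hx hy

theorem exists_isGluedSup_inl_inr (h : Isolated a b) (x : {z : L // z ≠ a ∧ z ≠ b}) (f : F) :
    ∃ z : Glued L F a b, IsGluedSup (Sum.inl x) (Sum.inr f) z := by
  by_cases hxa : (x : L) ≤ a
  · exact ⟨Sum.inr f, hxa, le_refl f, fun _ _ hw => hw⟩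
  · have hne : (x : L) ⊔ b ≠ a ∧ (x : L) ⊔ b ≠ b :=
      ⟨fun e => hxa (le_sup_left.trans_eq e),
        fun e => hxa (h.le_left_of_le_right x.2.2 (sup_eq_right.1 e))⟩
    refine ⟨Sum.inl ⟨(x : L) ⊔ b, hne⟩, le_sup_left (a := (x : L)),
      le_sup_right (a := (x : L)), ?_⟩
    rintro (w | w) hx hf
    · exact sup_le (α := L) hx hf
    · exact (hxa hx).elim

theorem exists_isGluedInf_inl_inr (h : Isolated a b) (x : {z : L // z ≠ a ∧ z ≠ b}) (f : F) :
    ∃ z : Glued L F a b, IsGluedInf (Sum.inl x) (Sum.inr f) z := by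
  by_cases hbx : b ≤ (x : L)
  · exact ⟨Sum.inr f, hbx, le_refl f, fun _ _ hw => hw⟩
  · have hne : (x : L) ⊓ a ≠ a ∧ (x : L) ⊓ a ≠ b :=
      ⟨fun e => hbx (h.right_le_of_left_le x.2.1 (inf_eq_right.1 e)),
        fun e => hbx (e.symm.trans_le inf_le_left)⟩
    refine ⟨Sum.inl ⟨(x : L) ⊓ a, hne⟩, inf_le_left (a := (x : L)),
      inf_le_right (a := (x : L)), ?_⟩
    rintro (w | w) hx hf
    · exact le_inf (α := L) hx hf
    · exact (hbx hx).elim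

theorem exists_isGluedSup (h : Isolated a b) (x y : Glued L F a b) : ∃ z, IsGluedSup x y z := by
  rcases x with x | f <;> rcases y with y | g
  · exact ⟨_, isGluedSup_inl x y (h.sup_ne x.2 y.2)⟩
  · exact exists_isGluedSup_inl_inr h x g
  · exact (exists_isGluedSup_inl_inr h y f).imp fun _ => IsGluedSup.symm
  · refine ⟨Sum.inr (f ⊔ g), le_sup_left (a := f), le_sup_right (a := f), ?_⟩
    rintro (w | w) hf hg
    · exact hf
    · exact sup_le (α := F) hf hg

theorem exists_isGluedInf (h : Isolated a b) (x y : Glued L F a b) : ∃ z, IsGluedInf x y z := by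
  rcases x with x | f <;> rcases y with y | g
  · exact ⟨_, isGluedInf_inl x y (h.inf_ne x.2 y.2)⟩
  · exact exists_isGluedInf_inl_inr h x g
  · exact (exists_isGluedInf_inl_inr h y f).imp fun _ => IsGluedInf.symm
  · refine ⟨Sum.inr (f ⊓ g), inf_le_left (a := f), inf_le_right (a := f), ?_⟩
    rintro (w | w) hf hg
    · exact hf
    · exact le_inf (α := F) hf hg

theorem exists_lattice_glued (h : Isolated a b) :
    ∃ inst : Lattice (Glued L F a b), ∀ x y, lleOf inst x y ↔ gle a b x y := by
  choose s hs using exists_isGluedSup (F := F) h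
  choose i hi using exists_isGluedInf (F := F) h
  exact ⟨{
    le := gle a b
    le_refl := gle_refl
    le_trans := fun _ _ _ => gle_trans h.1.lt
    le_antisymm := fun _ _ => gle_antisymm h.1.lt
    sup := s
    le_sup_left := fun x y => (hs x y).1
    le_sup_right := fun x y => (hs x y).2.1
    sup_le := fun x y z => (hs x y).2.2 z
    inf := i
    inf_le_left := fun x y => (hi x y).1
    inf_le_right := fun x y => (hi x y).2.1
    le_inf := fun x y z => (hi y z).2.2 x }, fun _ _ => Iff.rfl⟩

theorem IsGluedSup.sup_eq [Lattice (Glued L F a b)]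
    (hle : ∀ x y : Glued L F a b, x ≤ y ↔ gle a b x y) {x y z : Glued L F a b}
    (h : IsGluedSup x y z) : x ⊔ y = z :=
  le_antisymm (sup_le ((hle _ _).2 h.1) ((hle _ _).2 h.2.1))
    ((hle _ _).2 (h.2.2 _ ((hle _ _).1 le_sup_left) ((hle _ _).1 le_sup_right)))

theorem IsGluedInf.inf_eq [Lattice (Glued L F a b)]
    (hle : ∀ x y : Glued L F a b, x ≤ y ↔ gle a b x y) {x y z : Glued L F a b}
    (h : IsGluedInf x y z) : x ⊓ y = z :=
  le_antisymm ((hle _ _).2 (h.2.2 _ ((hle _ _).1 inf_le_left) ((hle _ _).1 inf_le_right)))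
    (le_inf ((hle _ _).2 h.1) ((hle _ _).2 h.2.1))

end Glued

/-! ### STATEMENT 13 -/

/-- Let `L` be a finite semidistributive lattice with more than two elements having
an isolated interval `[a, b]`, let `F` be an FN lattice, and order
`K = L^{a,b} ⊔ F` by `gle a b`.  Then `K` is a lattice and `L^{a,b}` is a
sublattice of `K`. -/
theorem statement13 (L F : Type) [Lattice L] [Lattice F] [Finite L]
    (hL : SD L) (hcard : 2 < Nat.card L) (a b : L) (hiso : Isolated a b)
    (hF : IsFN F) :
    (∃ inst : Lattice (Glued L F a b),
      ∀ x y : Glued L F a b, lleOf inst x y ↔ gle a b x y) ∧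
    (∀ [instK : Lattice (Glued L F a b)],
      (∀ x y : Glued L F a b, x ≤ y ↔ gle a b x y) →
      ∀ x y : {z : L // z ≠ a ∧ z ≠ b},
        (∃ h : ((x : L) ⊔ (y : L) ≠ a ∧ (x : L) ⊔ (y : L) ≠ b),
          (Sum.inl x ⊔ Sum.inl y : Glued L F a b) = Sum.inl ⟨(x : L) ⊔ (y : L), h⟩) ∧
        (∃ h : ((x : L) ⊓ (y : L) ≠ a ∧ (x : L) ⊓ (y : L) ≠ b),
          (Sum.inl x ⊓ Sum.inl y : Glued L F a b) = Sum.inl ⟨(x : L) ⊓ (y : L), h⟩)) := by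
  refine ⟨exists_lattice_glued hiso, fun {instK} hle x y => ⟨?_, ?_⟩⟩
  · exact ⟨hiso.sup_ne x.2 y.2, (isGluedSup_inl x y _).sup_eq hle⟩
  · exact ⟨hiso.inf_ne x.2 y.2, (isGluedInf_inl x y _).inf_eq hle⟩
end
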